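/- arXiv:1611.02130 — 3 statements merged into one kernel-verified Lean document; each statement's English description precedes it below -/
import Mathlib

section
/- There exists a unique F-algebra homomorphism ♭ from the universal Askey–Wilson algebra △_q into U_q(sl_2)^{⊗3} sending A ↦ Δ(Λ) ⊗ 1, B ↦ 1 ⊗ Δ(Λ), and γ ↦ Λ⊗1⊗Λ + (1⊗Λ⊗1)·Δ_2(Λ), where Δ is the comultiplication of U_q(sl_2), Δ_2 = (1⊗Δ)∘Δ, and Λ is the normalized Casimir element. -/
open scoped TensorProduct

/-- Generators of the universal Askey–Wilson algebra. -/
inductive AWGen : Type | A | B | C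

/-- The element `A + (qBC − q⁻¹CB)/(q² − q⁻²)` of the free algebra. -/
noncomputable def awNA (F : Type) [Field F] (q : F) : FreeAlgebra F AWGen :=
  FreeAlgebra.ι F AWGen.A +
    (q ^ 2 - q⁻¹ ^ 2)⁻¹ •
      (q • (FreeAlgebra.ι F AWGen.B * FreeAlgebra.ι F AWGen.C) -
        q⁻¹ • (FreeAlgebra.ι F AWGen.C * FreeAlgebra.ι F AWGen.B))

/-- The element `B + (qCA − q⁻¹AC)/(q² − q⁻²)` of the free algebra. -/
noncomputable def awNB (F : Type) [Field F] (q : F) : FreeAlgebra F AWGen :=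
  FreeAlgebra.ι F AWGen.B +
    (q ^ 2 - q⁻¹ ^ 2)⁻¹ •
      (q • (FreeAlgebra.ι F AWGen.C * FreeAlgebra.ι F AWGen.A) -
        q⁻¹ • (FreeAlgebra.ι F AWGen.A * FreeAlgebra.ι F AWGen.C))

/-- The element `C + (qAB − q⁻¹BA)/(q² − q⁻²)` of the free algebra. -/
noncomputable def awNC (F : Type) [Field F] (q : F) : FreeAlgebra F AWGen :=
  FreeAlgebra.ι F AWGen.C +
    (q ^ 2 - q⁻¹ ^ 2)⁻¹ •
      (q • (FreeAlgebra.ι F AWGen.A * FreeAlgebra.ι F AWGen.B) -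
        q⁻¹ • (FreeAlgebra.ι F AWGen.B * FreeAlgebra.ι F AWGen.A))

/-- Defining relations of the universal Askey–Wilson algebra: each of the three
normalized elements commutes with the generators. -/
inductive AWRel (F : Type) [Field F] (q : F) :
    FreeAlgebra F AWGen → FreeAlgebra F AWGen → Prop
  | Acen (g : AWGen) :
      AWRel F q (awNA F q * FreeAlgebra.ι F g) (FreeAlgebra.ι F g * awNA F q)
  | Bcen (g : AWGen) :
      AWRel F q (awNB F q * FreeAlgebra.ι F g) (FreeAlgebra.ι F g * awNB F q)
  | Ccen (g : AWGen) :
      AWRel F q (awNC F q * FreeAlgebra.ι F g) (FreeAlgebra.ι F g * awNC F q)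

/-- The universal Askey–Wilson algebra `△_q`. -/
abbrev AWAlg (F : Type) [Field F] (q : F) := RingQuot (AWRel F q)

/-- The generator `A` of `△_q`. -/
noncomputable def AWA (F : Type) [Field F] (q : F) : AWAlg F q :=
  RingQuot.mkAlgHom F (AWRel F q) (FreeAlgebra.ι F AWGen.A)

/-- The generator `B` of `△_q`. -/
noncomputable def AWB (F : Type) [Field F] (q : F) : AWAlg F q :=
  RingQuot.mkAlgHom F (AWRel F q) (FreeAlgebra.ι F AWGen.B)

/-- The generator `C` of `△_q`. -/
noncomputable def AWC (F : Type) [Field F] (q : F) : AWAlg F q :=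
  RingQuot.mkAlgHom F (AWRel F q) (FreeAlgebra.ι F AWGen.C)

/-- The central element `α` of `△_q`. -/
noncomputable def AWalpha (F : Type) [Field F] (q : F) : AWAlg F q :=
  (q + q⁻¹) • (AWA F q + (q ^ 2 - q⁻¹ ^ 2)⁻¹ •
    (q • (AWB F q * AWC F q) - q⁻¹ • (AWC F q * AWB F q)))

/-- The central element `β` of `△_q`. -/
noncomputable def AWbeta (F : Type) [Field F] (q : F) : AWAlg F q :=
  (q + q⁻¹) • (AWB F q + (q ^ 2 - q⁻¹ ^ 2)⁻¹ •
    (q • (AWC F q * AWA F q) - q⁻¹ • (AWA F q * AWC F q)))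

/-- The central element `γ` of `△_q`. -/
noncomputable def AWgamma (F : Type) [Field F] (q : F) : AWAlg F q :=
  (q + q⁻¹) • (AWC F q + (q ^ 2 - q⁻¹ ^ 2)⁻¹ •
    (q • (AWA F q * AWB F q) - q⁻¹ • (AWB F q * AWA F q)))

/-- The Casimir element `Ω` of `△_q`. -/
noncomputable def AWOmega (F : Type) [Field F] (q : F) : AWAlg F q :=
  q • (AWA F q * AWB F q * AWC F q) + q ^ 2 • (AWA F q) ^ 2
    + q⁻¹ ^ 2 • (AWB F q) ^ 2 + q ^ 2 • (AWC F q) ^ 2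
    - q • (AWA F q * AWalpha F q) - q⁻¹ • (AWB F q * AWbeta F q)
    - q • (AWC F q * AWgamma F q)

/-- The relations of `U_q(sl₂)` with rescaled `e`, `f`, in which the normalized Casimir element
`L = f * e + q K + q⁻¹ K⁻¹` is treated as a generator. -/
structure IsCasimirTriple {F U : Type} [Field F] [Ring U] [Algebra F U]
    (q : F) (e f K k L : U) : Prop where
  Kk : K * k = 1
  kK : k * K = 1
  Ke : K * e = q ^ 2 • (e * K)
  Kf : K * f = q⁻¹ ^ 2 • (f * K)
  ke : k * e = q⁻¹ ^ 2 • (e * k)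
  kf : k * f = q ^ 2 • (f * k)
  fe : f * e = L - q • K - q⁻¹ • k
  ef : e * f = L - q⁻¹ • K - q • k
  LK : L * K = K * L
  Lk : L * k = k * L
  Le : L * e = e * L
  Lf : L * f = f * L

section TripleTensor

variable {F U : Type} [Field F] [Ring U] [Algebra F U]

lemma mul_mul_of_mul_eq {a b c : U} (h : a * b = c) (x : U) : a * (b * x) = c * x := by
  rw [← mul_assoc, h]

namespace IsCasimirTriple

/-- Rewriting rules that bring words in the generators to the order `e`, `f`, `K`, `L`. -/
lemma normalize {q : F} {e f K k L : U} (h : IsCasimirTriple q e f K k L) :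
    (K * k = 1 ∧ k * K = 1 ∧ K * e = q ^ 2 • (e * K) ∧ K * f = q⁻¹ ^ 2 • (f * K) ∧
      k * e = q⁻¹ ^ 2 • (e * k) ∧ k * f = q ^ 2 • (f * k) ∧ f * e = L - q • K - q⁻¹ • k ∧
      e * f = L - q⁻¹ • K - q • k ∧ L * K = K * L ∧ L * k = k * L ∧ L * e = e * L ∧
      L * f = f * L) ∧
    ∀ x : U, K * (k * x) = x ∧ k * (K * x) = x ∧ K * (e * x) = q ^ 2 • (e * (K * x)) ∧
      K * (f * x) = q⁻¹ ^ 2 • (f * (K * x)) ∧ k * (e * x) = q⁻¹ ^ 2 • (e * (k * x)) ∧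
      k * (f * x) = q ^ 2 • (f * (k * x)) ∧
      f * (e * x) = L * x - q • (K * x) - q⁻¹ • (k * x) ∧
      e * (f * x) = L * x - q⁻¹ • (K * x) - q • (k * x) ∧ L * (K * x) = K * (L * x) ∧
      L * (k * x) = k * (L * x) ∧ L * (e * x) = e * (L * x) ∧ L * (f * x) = f * (L * x) := by
  refine ⟨⟨h.Kk, h.kK, h.Ke, h.Kf, h.ke, h.kf, h.fe, h.ef, h.LK, h.Lk, h.Le, h.Lf⟩,
    fun x => ?_⟩
  simp only [mul_mul_of_mul_eq h.Kk, mul_mul_of_mul_eq h.kK, mul_mul_of_mul_eq h.Ke,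
    mul_mul_of_mul_eq h.Kf, mul_mul_of_mul_eq h.ke, mul_mul_of_mul_eq h.kf,
    mul_mul_of_mul_eq h.fe, mul_mul_of_mul_eq h.ef, mul_mul_of_mul_eq h.LK,
    mul_mul_of_mul_eq h.Lk, mul_mul_of_mul_eq h.Le, mul_mul_of_mul_eq h.Lf, one_mul,
    sub_mul, smul_mul_assoc, mul_assoc, and_self]

lemma of_relations {q : F} (hq : q ≠ 0) (hν : q - q⁻¹ ≠ 0) {E Fg K k L : U}
    (hKk : K * k = 1) (hkK : k * K = 1) (hKE : K * E = q ^ 2 • (E * K))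
    (hKF : K * Fg = (q ^ 2)⁻¹ • (Fg * K))
    (hEF : E * Fg - Fg * E = (q - q⁻¹)⁻¹ • (K - k))
    (hL : L = (q - q⁻¹) ^ 2 • (Fg * E) + q • K + q⁻¹ • k) :
    IsCasimirTriple q ((q - q⁻¹) ^ 2 • E) Fg K k L := by
  have hq2 : q ^ 2 ≠ 0 := pow_ne_zero 2 hq
  have hkE : k * E = q⁻¹ ^ 2 • (E * k) := by
    have h1 : k * (K * E) * k = q ^ 2 • (k * E) := by
      rw [hKE, mul_smul_comm, smul_mul_assoc, mul_assoc, mul_assoc, hKk, mul_one]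
    rw [← mul_assoc, hkK, one_mul] at h1
    rw [h1, smul_smul, inv_pow, inv_mul_cancel₀ hq2, one_smul]
  have hkF : k * Fg = q ^ 2 • (Fg * k) := by
    have h1 : k * (K * Fg) * k = (q ^ 2)⁻¹ • (k * Fg) := by
      rw [hKF, mul_smul_comm, smul_mul_assoc, mul_assoc, mul_assoc, hKk, mul_one]
    rw [← mul_assoc, hkK, one_mul] at h1
    rw [h1, smul_smul, mul_inv_cancel₀ hq2, one_smul]
  have hEF' : E * Fg = Fg * E + (q - q⁻¹)⁻¹ • (K - k) := by rw [← hEF]; abel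
  have hν' : q ^ 2 - 1 ≠ 0 := by
    intro h0; apply hν; field_simp; linear_combination h0
  have hinv : (q - q⁻¹)⁻¹ = q * (q ^ 2 - 1)⁻¹ := by field_simp
  rw [hinv] at hEF'
  subst hL
  constructor
  case Kk => exact hKk
  case kK => exact hkK
  all_goals
    simp only [mul_add, add_mul, mul_sub, sub_mul, smul_mul_assoc, mul_smul_comm, mul_assoc,
      hKk, hkK, hKE, hKF, hkE, hkF, hEF', mul_mul_of_mul_eq hKF, mul_mul_of_mul_eq hkF,
      mul_mul_of_mul_eq hEF'] <;>
    match_scalars <;> field_simp <;> ring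

end IsCasimirTriple

variable (F) in
/-- The pure tensor `a ⊗ b ⊗ c`. -/
def pure3 (a b c : U) : U ⊗[F] (U ⊗[F] U) := a ⊗ₜ[F] (b ⊗ₜ[F] c)

lemma pure3_mul (a b c a' b' c' : U) :
    pure3 F a b c * pure3 F a' b' c' = pure3 F (a * a') (b * b') (c * c') := by
  simp [pure3]

lemma pure3_sub₁ (a a' b c : U) : pure3 F (a - a') b c = pure3 F a b c - pure3 F a' b c := by
  simp [pure3, TensorProduct.sub_tmul]
lemma pure3_sub₂ (a b b' c : U) : pure3 F a (b - b') c = pure3 F a b c - pure3 F a b' c := by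
  simp [pure3, TensorProduct.sub_tmul, TensorProduct.tmul_sub]
lemma pure3_sub₃ (a b c c' : U) : pure3 F a b (c - c') = pure3 F a b c - pure3 F a b c' := by
  simp [pure3, TensorProduct.tmul_sub]
lemma pure3_smul₁ (r : F) (a b c : U) : pure3 F (r • a) b c = r • pure3 F a b c := by
  simp [pure3, TensorProduct.smul_tmul']
lemma pure3_smul₂ (r : F) (a b c : U) : pure3 F a (r • b) c = r • pure3 F a b c := by
  rw [pure3, ← TensorProduct.smul_tmul', TensorProduct.tmul_smul, pure3]
lemma pure3_smul₃ (r : F) (a b c : U) : pure3 F a b (r • c) = r • pure3 F a b c := by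
  simp [pure3]

/-- `Δ(Λ) ⊗ 1` in terms of the generators. -/
def casimirA (q : F) (e f K k L : U) : U ⊗[F] (U ⊗[F] U) :=
  pure3 F L k 1 + pure3 F K L 1 - (q + q⁻¹) • pure3 F K k 1 + pure3 F (f * K) (k * e) 1
    + pure3 F e f 1

/-- `1 ⊗ Δ(Λ)` in terms of the generators. -/
def casimirB (q : F) (e f K k L : U) : U ⊗[F] (U ⊗[F] U) :=
  pure3 F 1 L k + pure3 F 1 K L - (q + q⁻¹) • pure3 F 1 K k + pure3 F 1 (f * K) (k * e)
    + pure3 F 1 e f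

/-- The image of the third Askey–Wilson generator. -/
def casimirC (q : F) (e f K k L : U) : U ⊗[F] (U ⊗[F] U) :=
  pure3 F L 1 k - q⁻¹ • pure3 F L f (e * k) + pure3 F K 1 L - (q + q⁻¹) • pure3 F K 1 k
    + (1 + q⁻¹ ^ 2) • pure3 F K f (e * k) + q⁻¹ ^ 2 • pure3 F (f * K) k (e * k)
    - q⁻¹ • pure3 F e (f * K) L + (1 + q⁻¹ ^ 2) • pure3 F e (f * K) k
    - q⁻¹ ^ 3 • pure3 F e (f * (f * K)) (e * k) + pure3 F e K f

/-- `Δ₂(Λ)` in terms of the generators. -/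
def casimirT (q : F) (e f K k L : U) : U ⊗[F] (U ⊗[F] U) :=
  pure3 F L k k + pure3 F K 1 1 * casimirB q e f K k L - (q + q⁻¹) • pure3 F K k k
    + pure3 F (f * K) (k * e) k + pure3 F (f * K) 1 (k * e) + pure3 F e f k + pure3 F e 1 f

namespace IsCasimirTriple

variable {q : F} {e f K k L : U}

set_option maxHeartbeats 4000000 in
lemma askeyWilson_relations (hq : q ≠ 0) (h : IsCasimirTriple q e f K k L)
    (A B C T : U ⊗[F] (U ⊗[F] U)) (hA : A = casimirA q e f K k L)
    (hB : B = casimirB q e f K k L) (hC : C = casimirC q e f K k L)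
    (hT : T = casimirT q e f K k L) :
    (q • (A * B) - q⁻¹ • (B * A) =
      (q - q⁻¹) • (pure3 F L 1 L + pure3 F 1 L 1 * T) - (q ^ 2 - q⁻¹ ^ 2) • C) ∧
    (q • (B * C) - q⁻¹ • (C * B) =
      (q - q⁻¹) • (pure3 F L L 1 + pure3 F 1 1 L * T) - (q ^ 2 - q⁻¹ ^ 2) • A) ∧
    (q • (C * A) - q⁻¹ • (A * C) =
      (q - q⁻¹) • (pure3 F 1 L L + pure3 F L 1 1 * T) - (q ^ 2 - q⁻¹ ^ 2) • B) := by
  subst hA hB hC hT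
  refine ⟨?_, ?_, ?_⟩
  all_goals
    simp only [casimirA, casimirB, casimirC, casimirT, mul_add, add_mul, mul_sub, sub_mul,
      smul_mul_assoc, mul_smul_comm, pure3_mul, mul_one, one_mul, mul_assoc, h.normalize,
      pure3_sub₁, pure3_sub₂, pure3_sub₃,
      pure3_smul₁, pure3_smul₂, pure3_smul₃]
    match_scalars <;> field_simp <;> ring

set_option maxHeartbeats 4000000 in
lemma commute_casimirT (hq : q ≠ 0) (h : IsCasimirTriple q e f K k L) :
    Commute (casimirT (F := F) q e f K k L) (casimirA q e f K k L) ∧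
    Commute (casimirT (F := F) q e f K k L) (casimirB q e f K k L) ∧
    Commute (casimirT (F := F) q e f K k L) (casimirC q e f K k L) := by
  refine ⟨?_, ?_, ?_⟩
  all_goals
    rw [Commute, SemiconjBy]
    simp only [casimirA, casimirB, casimirC, casimirT, mul_add, add_mul, mul_sub, sub_mul,
      smul_mul_assoc, mul_smul_comm, pure3_mul, mul_one, one_mul, mul_assoc, h.normalize,
      pure3_sub₁, pure3_sub₂, pure3_sub₃,
      pure3_smul₁, pure3_smul₂, pure3_smul₃]
    match_scalars <;> field_simp <;> ring

lemma commute_pure3 (h : IsCasimirTriple q e f K k L) {a b c : U}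
    (ha : a = 1 ∨ a = L) (hb : b = 1 ∨ b = L) (hc : c = 1 ∨ c = L) :
    Commute (pure3 F a b c) (casimirA q e f K k L) ∧
    Commute (pure3 F a b c) (casimirB q e f K k L) ∧
    Commute (pure3 F a b c) (casimirC q e f K k L) := by
  simp only [Commute, SemiconjBy]
  rcases ha with rfl | rfl <;> rcases hb with rfl | rfl <;> rcases hc with rfl | rfl <;>
    simp only [casimirA, casimirB, casimirC, mul_add, add_mul, mul_sub, sub_mul,
      smul_mul_assoc, mul_smul_comm, pure3_mul, mul_one, one_mul, mul_assoc, h.normalize,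
      and_self]

end IsCasimirTriple

end TripleTensor

section Lift

variable {F : Type} [Field F] {q : F} {R : Type} [Ring R] [Algebra F R]

lemma normalized_eq {z ν : F} (hz : z ≠ 0) {x y g : R} (h : y = ν • g - z • x) :
    x + z⁻¹ • y = (z⁻¹ * ν) • g := by
  rw [h, smul_sub, smul_smul, smul_smul, inv_mul_cancel₀ hz, one_smul]
  abel

lemma AWAlg.exists_lift (hz : q ^ 2 - q⁻¹ ^ 2 ≠ 0) (a b c α β γ : R)
    (hab : q • (a * b) - q⁻¹ • (b * a) = (q - q⁻¹) • γ - (q ^ 2 - q⁻¹ ^ 2) • c)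
    (hbc : q • (b * c) - q⁻¹ • (c * b) = (q - q⁻¹) • α - (q ^ 2 - q⁻¹ ^ 2) • a)
    (hca : q • (c * a) - q⁻¹ • (a * c) = (q - q⁻¹) • β - (q ^ 2 - q⁻¹ ^ 2) • b)
    (hα : Commute α a ∧ Commute α b ∧ Commute α c)
    (hβ : Commute β a ∧ Commute β b ∧ Commute β c)
    (hγ : Commute γ a ∧ Commute γ b ∧ Commute γ c) :
    ∃ φ : AWAlg F q →ₐ[F] R, φ (AWA F q) = a ∧ φ (AWB F q) = b ∧ φ (AWC F q) = c := by
  let v : AWGen → R := fun g => AWGen.casesOn g a b c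
  let ψ : FreeAlgebra F AWGen →ₐ[F] R := FreeAlgebra.lift F v
  have hA : ψ (FreeAlgebra.ι F AWGen.A) = a := FreeAlgebra.lift_ι_apply v _
  have hB : ψ (FreeAlgebra.ι F AWGen.B) = b := FreeAlgebra.lift_ι_apply v _
  have hC : ψ (FreeAlgebra.ι F AWGen.C) = c := FreeAlgebra.lift_ι_apply v _
  have hψ : ∀ ⦃x y⦄, AWRel F q x y → ψ x = ψ y := by
    rintro _ _ (⟨g⟩ | ⟨g⟩ | ⟨g⟩) <;> rw [map_mul, map_mul]
    · have h : ψ (awNA F q) = ((q ^ 2 - q⁻¹ ^ 2)⁻¹ * (q - q⁻¹)) • α := by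
        rw [← normalized_eq hz hbc]
        simp only [awNA, map_add, map_sub, map_smul, map_mul, hA, hB, hC]
      rw [h]
      cases g <;> simp only [hA, hB, hC]
      exacts [hα.1.smul_left _, hα.2.1.smul_left _, hα.2.2.smul_left _]
    · have h : ψ (awNB F q) = ((q ^ 2 - q⁻¹ ^ 2)⁻¹ * (q - q⁻¹)) • β := by
        rw [← normalized_eq hz hca]
        simp only [awNB, map_add, map_sub, map_smul, map_mul, hA, hB, hC]
      rw [h]
      cases g <;> simp only [hA, hB, hC]
      exacts [hβ.1.smul_left _, hβ.2.1.smul_left _, hβ.2.2.smul_left _]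
    · have h : ψ (awNC F q) = ((q ^ 2 - q⁻¹ ^ 2)⁻¹ * (q - q⁻¹)) • γ := by
        rw [← normalized_eq hz hab]
        simp only [awNC, map_add, map_sub, map_smul, map_mul, hA, hB, hC]
      rw [h]
      cases g <;> simp only [hA, hB, hC]
      exacts [hγ.1.smul_left _, hγ.2.1.smul_left _, hγ.2.2.smul_left _]
  refine ⟨RingQuot.liftAlgHom F ⟨ψ, hψ⟩, ?_, ?_, ?_⟩
  · rw [AWA, RingQuot.liftAlgHom_mkAlgHom_apply, hA]
  · rw [AWB, RingQuot.liftAlgHom_mkAlgHom_apply, hB]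
  · rw [AWC, RingQuot.liftAlgHom_mkAlgHom_apply, hC]

lemma map_AWgamma (φ : AWAlg F q →ₐ[F] R) :
    φ (AWgamma F q) = (q + q⁻¹) • (φ (AWC F q) + (q ^ 2 - q⁻¹ ^ 2)⁻¹ •
      (q • (φ (AWA F q) * φ (AWB F q)) - q⁻¹ • (φ (AWB F q) * φ (AWA F q)))) := by
  simp only [AWgamma, map_add, map_sub, map_smul, map_mul]

lemma AWAlg.algHom_ext (hq : q + q⁻¹ ≠ 0) {φ ψ : AWAlg F q →ₐ[F] R}
    (hA : φ (AWA F q) = ψ (AWA F q)) (hB : φ (AWB F q) = ψ (AWB F q))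
    (hγ : φ (AWgamma F q) = ψ (AWgamma F q)) : φ = ψ := by
  rw [map_AWgamma, map_AWgamma, hA, hB] at hγ
  have hC : φ (AWC F q) = ψ (AWC F q) := add_right_cancel (smul_right_injective R hq hγ)
  apply RingQuot.ringQuot_ext'
  apply FreeAlgebra.hom_ext
  funext g
  cases g
  exacts [hA, hB, hC]

end Lift

/-- There exists a unique `F`-algebra homomorphism
`♭ : △_q → U_q(sl₂)^{⊗3}` sending `A ↦ Δ(Λ)⊗1`, `B ↦ 1⊗Δ(Λ)` and
`γ ↦ Λ⊗1⊗Λ + (1⊗Λ⊗1)·Δ₂(Λ)`, where `Δ` is the comultiplication,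
`Δ₂ = (1⊗Δ)∘Δ`, and `Λ` is the normalized Casimir element. -/
theorem aw_embedding_exists_unique (F : Type) [Field F] (q : F) (hq0 : q ≠ 0)
    (hq4 : q ^ 4 ≠ 1)
    (U : Type) [Ring U] [Algebra F U] (E K Kinv Fg : U)
    (hKKinv : K * Kinv = 1) (hKinvK : Kinv * K = 1)
    (hKE : K * E = q ^ 2 • (E * K))
    (hKF : K * Fg = (q ^ 2)⁻¹ • (Fg * K))
    (hEF : E * Fg - Fg * E = (q - q⁻¹)⁻¹ • (K - Kinv))
    (Lam : U) (hLam : Lam = (q - q⁻¹) ^ 2 • (Fg * E) + q • K + q⁻¹ • Kinv)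
    (Δ : U →ₐ[F] U ⊗[F] U)
    (hΔE : Δ E = E ⊗ₜ[F] 1 + K ⊗ₜ[F] E)
    (hΔF : Δ Fg = Fg ⊗ₜ[F] Kinv + 1 ⊗ₜ[F] Fg)
    (hΔK : Δ K = K ⊗ₜ[F] K)
    (hΔKinv : Δ Kinv = Kinv ⊗ₜ[F] Kinv)
    (Δ₂ : U →ₐ[F] U ⊗[F] (U ⊗[F] U))
    (hΔ₂ : Δ₂ = (Algebra.TensorProduct.map (AlgHom.id F U) Δ).comp Δ) :
    ∃! φ : AWAlg F q →ₐ[F] U ⊗[F] (U ⊗[F] U),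
      φ (AWA F q) =
          (Algebra.TensorProduct.map (AlgHom.id F U)
            (Algebra.TensorProduct.includeLeft : U →ₐ[F] U ⊗[F] U)) (Δ Lam) ∧
      φ (AWB F q) =
          (Algebra.TensorProduct.includeRight : U ⊗[F] U →ₐ[F] U ⊗[F] (U ⊗[F] U)) (Δ Lam) ∧
      φ (AWgamma F q) =
          Lam ⊗ₜ[F] ((1 : U) ⊗ₜ[F] Lam) +
            ((1 : U) ⊗ₜ[F] (Lam ⊗ₜ[F] (1 : U))) * Δ₂ Lam := by
  have hq2 : q ^ 2 - 1 ≠ 0 := fun h => hq4 (by linear_combination (q ^ 2 + 1) * h)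
  have hq2' : q ^ 2 + 1 ≠ 0 := fun h => hq4 (by linear_combination (q ^ 2 - 1) * h)
  have hν : q - q⁻¹ ≠ 0 := by
    have : q - q⁻¹ = (q ^ 2 - 1) / q := by field_simp
    rw [this]; exact div_ne_zero hq2 hq0
  have hμ : q + q⁻¹ ≠ 0 := by
    have : q + q⁻¹ = (q ^ 2 + 1) / q := by field_simp
    rw [this]; exact div_ne_zero hq2' hq0
  have hfac : q ^ 2 - q⁻¹ ^ 2 = (q + q⁻¹) * (q - q⁻¹) := by ring
  have hz : q ^ 2 - q⁻¹ ^ 2 ≠ 0 := hfac ▸ mul_ne_zero hμ hν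
  have h := IsCasimirTriple.of_relations hq0 hν hKKinv hKinvK hKE hKF hEF hLam
  have hΔL : Δ Lam = Lam ⊗ₜ[F] Kinv + K ⊗ₜ[F] Lam - (q + q⁻¹) • (K ⊗ₜ[F] Kinv)
      + (Fg * K) ⊗ₜ[F] (Kinv * ((q - q⁻¹) ^ 2 • E)) + ((q - q⁻¹) ^ 2 • E) ⊗ₜ[F] Fg := by
    rw [hLam]
    simp only [map_add, map_smul, map_mul, hΔE, hΔF, hΔK, hΔKinv, add_mul, mul_add,
      Algebra.TensorProduct.tmul_mul_tmul, mul_one, one_mul, TensorProduct.add_tmul,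
      TensorProduct.tmul_add, TensorProduct.tmul_smul, ← TensorProduct.smul_tmul',
      mul_smul_comm]
    match_scalars <;> field_simp <;> ring
  have hA : (Algebra.TensorProduct.map (AlgHom.id F U)
      (Algebra.TensorProduct.includeLeft : U →ₐ[F] U ⊗[F] U)) (Δ Lam) =
      casimirA q ((q - q⁻¹) ^ 2 • E) Fg K Kinv Lam := by
    rw [hΔL]
    simp only [map_add, map_sub, map_smul, Algebra.TensorProduct.map_tmul, AlgHom.id_apply,
      Algebra.TensorProduct.includeLeft_apply, casimirA, pure3]
  have hB : (Algebra.TensorProduct.includeRight : U ⊗[F] U →ₐ[F] U ⊗[F] (U ⊗[F] U)) (Δ Lam) =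
      casimirB q ((q - q⁻¹) ^ 2 • E) Fg K Kinv Lam := by
    rw [hΔL]
    simp only [map_add, map_sub, map_smul, Algebra.TensorProduct.includeRight_apply, casimirB,
      pure3]
  have hT : Δ₂ Lam = casimirT q ((q - q⁻¹) ^ 2 • E) Fg K Kinv Lam := by
    have hKB : K ⊗ₜ[F] Δ Lam =
        pure3 F K 1 1 * casimirB q ((q - q⁻¹) ^ 2 • E) Fg K Kinv Lam := by
      rw [← hB, pure3, Algebra.TensorProduct.includeRight_apply,
        ← Algebra.TensorProduct.one_def, Algebra.TensorProduct.tmul_mul_tmul, mul_one, one_mul]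
    rw [hΔ₂, AlgHom.comp_apply, hΔL]
    simp only [map_add, map_sub, map_smul, map_mul, Algebra.TensorProduct.map_tmul,
      AlgHom.id_apply, hKB, casimirT, hΔE, hΔF, hΔKinv, pure3, mul_add,
      Algebra.TensorProduct.tmul_mul_tmul, mul_one, mul_smul_comm, hKinvK,
      TensorProduct.tmul_add, TensorProduct.tmul_smul, ← TensorProduct.smul_tmul', smul_add]
    abel
  rw [hA, hB, hT]
  obtain ⟨hab, hbc, hca⟩ := h.askeyWilson_relations hq0 _ _ _ _ rfl rfl rfl rfl
  obtain ⟨hTA, hTB, hTC⟩ := h.commute_casimirT hq0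
  have hcomm : ∀ {a b c a' b' c' : U}, a = 1 ∨ a = Lam → b = 1 ∨ b = Lam → c = 1 ∨ c = Lam →
      a' = 1 ∨ a' = Lam → b' = 1 ∨ b' = Lam → c' = 1 ∨ c' = Lam →
      ∀ g, g = casimirA q ((q - q⁻¹) ^ 2 • E) Fg K Kinv Lam ∨
        g = casimirB q ((q - q⁻¹) ^ 2 • E) Fg K Kinv Lam ∨
        g = casimirC q ((q - q⁻¹) ^ 2 • E) Fg K Kinv Lam →
      Commute (pure3 F a b c +
        pure3 F a' b' c' * casimirT q ((q - q⁻¹) ^ 2 • E) Fg K Kinv Lam) g := by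
    intro a b c a' b' c' ha hb hc ha' hb' hc' g hg
    obtain ⟨h1, h2, h3⟩ := h.commute_pure3 ha hb hc
    obtain ⟨h1', h2', h3'⟩ := h.commute_pure3 ha' hb' hc'
    rcases hg with rfl | rfl | rfl
    exacts [h1.add_left (h1'.mul_left hTA), h2.add_left (h2'.mul_left hTB),
      h3.add_left (h3'.mul_left hTC)]
  obtain ⟨φ, hφA, hφB, hφC⟩ := AWAlg.exists_lift hz _ _ _ _ _ _ hab hbc hca
    (by refine ⟨hcomm ?_ ?_ ?_ ?_ ?_ ?_ _ ?_, hcomm ?_ ?_ ?_ ?_ ?_ ?_ _ ?_,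
          hcomm ?_ ?_ ?_ ?_ ?_ ?_ _ ?_⟩ <;> simp)
    (by refine ⟨hcomm ?_ ?_ ?_ ?_ ?_ ?_ _ ?_, hcomm ?_ ?_ ?_ ?_ ?_ ?_ _ ?_,
          hcomm ?_ ?_ ?_ ?_ ?_ ?_ _ ?_⟩ <;> simp)
    (by refine ⟨hcomm ?_ ?_ ?_ ?_ ?_ ?_ _ ?_, hcomm ?_ ?_ ?_ ?_ ?_ ?_ _ ?_,
          hcomm ?_ ?_ ?_ ?_ ?_ ?_ _ ?_⟩ <;> simp)
  have hφγ : φ (AWgamma F q) = pure3 F Lam 1 Lam +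
      pure3 F 1 Lam 1 * casimirT q ((q - q⁻¹) ^ 2 • E) Fg K Kinv Lam := by
    rw [map_AWgamma, hφA, hφB, hφC, normalized_eq hz hab, smul_smul]
    have : (q + q⁻¹) * ((q ^ 2 - q⁻¹ ^ 2)⁻¹ * (q - q⁻¹)) = 1 := by
      rw [hfac, mul_inv, mul_assoc (q + q⁻¹)⁻¹, inv_mul_cancel₀ hν, mul_one,
        mul_inv_cancel₀ hμ]
    rw [this, one_smul]
  refine ⟨φ, ⟨hφA, hφB, hφγ⟩, ?_⟩
  rintro ψ ⟨hψA, hψB, hψγ⟩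
  exact AWAlg.algHom_ext hμ (hψA.trans hφA.symm) (hψB.trans hφB.symm) (hψγ.trans hφγ.symm)
end

section
/- The algebra homomorphism ♭ : △_q → U_q(sl_2)^{⊗3} determined by A ↦ Δ(Λ)⊗1, B ↦ 1⊗Δ(Λ), γ ↦ Λ⊗1⊗Λ + (1⊗Λ⊗1)·Δ_2(Λ) is injective. -/
open scoped TensorProduct


/-- Generators of the quantum algebra `U_q(sl₂)`. -/
inductive UqGen : Type | E | K | Kinv | F

/-- The defining relations of the quantum algebra `U_q(sl₂)`. -/
inductive UqRel (F : Type) [Field F] (q : F) :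
    FreeAlgebra F UqGen → FreeAlgebra F UqGen → Prop
  | KKinv : UqRel F q (FreeAlgebra.ι F UqGen.K * FreeAlgebra.ι F UqGen.Kinv) 1
  | KinvK : UqRel F q (FreeAlgebra.ι F UqGen.Kinv * FreeAlgebra.ι F UqGen.K) 1
  | KE : UqRel F q (FreeAlgebra.ι F UqGen.K * FreeAlgebra.ι F UqGen.E)
      (q ^ 2 • (FreeAlgebra.ι F UqGen.E * FreeAlgebra.ι F UqGen.K))
  | KF : UqRel F q (FreeAlgebra.ι F UqGen.K * FreeAlgebra.ι F UqGen.F)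
      ((q ^ 2)⁻¹ • (FreeAlgebra.ι F UqGen.F * FreeAlgebra.ι F UqGen.K))
  | EF : UqRel F q
      (FreeAlgebra.ι F UqGen.E * FreeAlgebra.ι F UqGen.F -
        FreeAlgebra.ι F UqGen.F * FreeAlgebra.ι F UqGen.E)
      ((q - q⁻¹)⁻¹ • (FreeAlgebra.ι F UqGen.K - FreeAlgebra.ι F UqGen.Kinv))

/-- The quantum algebra `U_q(sl₂)`. -/
abbrev UqAlg (F : Type) [Field F] (q : F) := RingQuot (UqRel F q)

/-- The generator `E` of `U_q(sl₂)`. -/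
noncomputable def UqE (F : Type) [Field F] (q : F) : UqAlg F q :=
  RingQuot.mkAlgHom F (UqRel F q) (FreeAlgebra.ι F UqGen.E)

/-- The generator `K` of `U_q(sl₂)`. -/
noncomputable def UqK (F : Type) [Field F] (q : F) : UqAlg F q :=
  RingQuot.mkAlgHom F (UqRel F q) (FreeAlgebra.ι F UqGen.K)

/-- The generator `K⁻¹` of `U_q(sl₂)`. -/
noncomputable def UqKinv (F : Type) [Field F] (q : F) : UqAlg F q :=
  RingQuot.mkAlgHom F (UqRel F q) (FreeAlgebra.ι F UqGen.Kinv)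

/-- The generator `F` of `U_q(sl₂)`. -/
noncomputable def UqF (F : Type) [Field F] (q : F) : UqAlg F q :=
  RingQuot.mkAlgHom F (UqRel F q) (FreeAlgebra.ι F UqGen.F)

/-- The normalized Casimir element `Λ = (q-q⁻¹)² FE + qK + q⁻¹K⁻¹` of `U_q(sl₂)`. -/
noncomputable def UqLam (F : Type) [Field F] (q : F) : UqAlg F q :=
  (q - q⁻¹) ^ 2 • (UqF F q * UqE F q) + q • UqK F q + q⁻¹ • UqKinv F q


theorem uqAlg_adjoin_eq_top (F : Type) [Field F] (q : F) :
    Algebra.adjoin F {UqE F q, UqF F q, UqK F q, UqKinv F q} = ⊤ := by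
  rw [eq_top_iff]
  rintro x -
  obtain ⟨y, rfl⟩ := RingQuot.mkAlgHom_surjective F (UqRel F q) x
  induction y using FreeAlgebra.induction with
  | grade0 r => rw [AlgHom.commutes]; exact Subalgebra.algebraMap_mem _ r
  | grade1 g =>
    apply Algebra.subset_adjoin
    cases g <;> simp [UqE, UqF, UqK, UqKinv]
  | mul a b ha hb => rw [map_mul]; exact mul_mem ha hb
  | add a b ha hb => rw [map_add]; exact add_mem ha hb

/-- Elements of an algebra satisfying the defining relations of `U_q(sl₂)` give an algebra
homomorphism out of `U_q(sl₂)`. -/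
noncomputable def uqLift {F : Type} [Field F] {q : F} {T : Type*} [Ring T] [Algebra F T]
    (e f k k' : T) (hkk' : k * k' = 1) (hk'k : k' * k = 1)
    (hke : k * e = q ^ 2 • (e * k)) (hkf : k * f = (q ^ 2)⁻¹ • (f * k))
    (hef : e * f - f * e = (q - q⁻¹)⁻¹ • (k - k')) : UqAlg F q →ₐ[F] T :=
  RingQuot.liftAlgHom F ⟨FreeAlgebra.lift F fun g => match g with
    | UqGen.E => e
    | UqGen.K => k
    | UqGen.Kinv => k'
    | UqGen.F => f, by
    intro x y h
    cases h <;> simpa⟩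

section uqLift

variable {F : Type} [Field F] {q : F} {T : Type*} [Ring T] [Algebra F T]
    {e f k k' : T} {hkk' : k * k' = 1} {hk'k : k' * k = 1}
    {hke : k * e = q ^ 2 • (e * k)} {hkf : k * f = (q ^ 2)⁻¹ • (f * k)}
    {hef : e * f - f * e = (q - q⁻¹)⁻¹ • (k - k')}

@[simp] theorem uqLift_E : uqLift e f k k' hkk' hk'k hke hkf hef (UqE F q) = e := by
  simp [uqLift, UqE]

@[simp] theorem uqLift_F : uqLift e f k k' hkk' hk'k hke hkf hef (UqF F q) = f := by
  simp [uqLift, UqF]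

@[simp] theorem uqLift_K : uqLift e f k k' hkk' hk'k hke hkf hef (UqK F q) = k := by
  simp [uqLift, UqK]

@[simp] theorem uqLift_Kinv : uqLift e f k k' hkk' hk'k hke hkf hef (UqKinv F q) = k' := by
  simp [uqLift, UqKinv]

end uqLift

/-- Two representations of `U_q(sl₂)` commute as soon as they do so on generators. -/
theorem uq_commute_of_generators {F : Type} [Field F] {q : F} {T : Type*} [Ring T] [Algebra F T]
    (ρ σ : UqAlg F q →ₐ[F] T)
    (h : ∀ x ∈ ({UqE F q, UqF F q, UqK F q, UqKinv F q} : Set (UqAlg F q)),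
      ∀ y ∈ ({UqE F q, UqF F q, UqK F q, UqKinv F q} : Set (UqAlg F q)),
      Commute (ρ x) (σ y)) (x y : UqAlg F q) : Commute (ρ x) (σ y) := by
  have hx : x ∈ Algebra.adjoin F {UqE F q, UqF F q, UqK F q, UqKinv F q} := by
    rw [uqAlg_adjoin_eq_top]; trivial
  have hy : y ∈ Algebra.adjoin F {UqE F q, UqF F q, UqK F q, UqKinv F q} := by
    rw [uqAlg_adjoin_eq_top]; trivial
  induction hx using Algebra.adjoin_induction with
  | mem x hx =>
    induction hy using Algebra.adjoin_induction with
    | mem y hy => exact h x hx y hy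
    | algebraMap r => rw [AlgHom.commutes]; exact Algebra.commute_algebraMap_right r _
    | add y z _ _ hy hz => rw [map_add]; exact hy.add_right hz
    | mul y z _ _ hy hz => rw [map_mul]; exact hy.mul_right hz
  | algebraMap r => rw [AlgHom.commutes]; exact Algebra.commute_algebraMap_left r _
  | add y z _ _ hy hz => rw [map_add]; exact hy.add_left hz
  | mul y z _ _ hy hz => rw [map_mul]; exact hy.mul_left hz

/-- The difference operator `f ↦ (n ↦ c n * f (n + s))`. -/
def weightedShift (F : Type*) [Field F] {R : Type*} [Field R] [Algebra F R]
    {I : Type*} [AddCommGroup I] (c : I → R) (s : I) : Module.End F (I → R) where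
  toFun f n := c n * f (n + s)
  map_add' f g := by ext n; simp [mul_add]
  map_smul' r f := by ext n; simp

section weightedShift

variable {F : Type} [Field F] {R : Type*} [Field R] [Algebra F R] {I : Type*} [AddCommGroup I]

@[simp] theorem weightedShift_apply (c : I → R) (s : I) (f : I → R) (n : I) :
    weightedShift F c s f n = c n * f (n + s) := rfl

theorem weightedShift_commute {c d : I → R} {s t : I} (hc : ∀ n, c (n + t) = c n)
    (hd : ∀ n, d (n + s) = d n) : Commute (weightedShift F c s) (weightedShift F d t) := by
  ext f n
  simp [hc, hd, add_right_comm n s t, mul_left_comm]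

/-- Representation of `U_q(sl₂)` by difference operators in the direction `s`, on which the
normalized Casimir element acts as the scalar `l`. -/
noncomputable def uqShiftRep (q : F) (hq0 : q ≠ 0) (hq4 : q ^ 4 ≠ 1) (x : I → R) (s : I)
    (ε l : R) (hε : ε ≠ 0) (hx0 : ∀ n, x n ≠ 0)
    (hx : ∀ n, x (n + s) = algebraMap F R q ^ 2 * x n) :
    UqAlg F q →ₐ[F] Module.End F (I → R) :=
  have hQ0 : algebraMap F R q ≠ 0 := by simpa using hq0
  have hx' (n) : x (n - s) = (algebraMap F R q ^ 2)⁻¹ * x n := by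
    have := hx (n - s)
    rw [sub_add_cancel] at this
    rw [this]; field_simp
  uqLift
    (weightedShift F (fun _ => ε) (-s))
    (weightedShift F (fun n => ((algebraMap F R (q - q⁻¹)) ^ 2)⁻¹ * ε⁻¹ *
      (l - algebraMap F R q * x n - (algebraMap F R q)⁻¹ * (x n)⁻¹)) s)
    (weightedShift F x 0)
    (weightedShift F (fun n => (x n)⁻¹) 0)
    (by ext f n; simp [hx0])
    (by ext f n; simp [hx0])
    (by
      ext f n
      rw [LinearMap.smul_apply, Pi.smul_apply, Algebra.smul_def]
      simp [hx', ← sub_eq_add_neg]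
      field_simp)
    (by ext f n; simp [hx, Algebra.smul_def]; field_simp)
    (by
      have hh : algebraMap F R q ^ 2 - 1 ≠ 0 := by
        rw [← map_pow, ← map_one (algebraMap F R), ← map_sub]
        simp only [ne_eq, map_eq_zero]
        intro h
        exact hq4 (by linear_combination (q ^ 2 + 1) * h)
      ext f n
      simp [hx', Algebra.smul_def, ← sub_eq_add_neg]
      have := hx0 n
      field_simp
      ring)

end weightedShift

/-- A bi-infinite geometric sequence of nonzero elements with ratio `Q ^ 2`. -/
structure QGeometric {R : Type*} [Field R] (Q : R) (X : ℤ → R) : Prop where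
  ne_zero (a : ℤ) : X a ≠ 0
  add_one (a : ℤ) : X (a + 1) = Q ^ 2 * X a

theorem QGeometric.sub_one {R : Type*} [Field R] {Q : R} {X : ℤ → R} (hX : QGeometric Q X)
    (hQ : Q ≠ 0) (a : ℤ) : X (a - 1) = (Q ^ 2)⁻¹ * X a := by
  have := hX.add_one (a - 1)
  rw [sub_add_cancel] at this
  rw [this]
  field_simp

section act

variable {R : Type*} [Field R] (Q u v l₁ l₂ l₃ : R) (X Y Z : ℤ → R)

/-- The coefficient `l - Q x - Q⁻¹ x⁻¹` of the raising operators. -/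
def phi (l x : R) : R := l - Q * x - Q⁻¹ * x⁻¹

/-- The action of `Δ(Λ) ⊗ 1` on functions on `ℤ³`. -/
def actA (f : ℤ × ℤ × ℤ → R) : ℤ × ℤ × ℤ → R := fun n =>
  (l₁ * (Y n.2.1)⁻¹ + l₂ * X n.1 - (Q + Q⁻¹) * X n.1 * (Y n.2.1)⁻¹) * f n
    + u * phi Q l₂ (Y n.2.1) * f (n.1 - 1, n.2.1 + 1, n.2.2)
    + u⁻¹ * Q ^ 2 * X n.1 * (Y n.2.1)⁻¹ * phi Q l₁ (X n.1) * f (n.1 + 1, n.2.1 - 1, n.2.2)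

/-- The action of `1 ⊗ Δ(Λ)` on functions on `ℤ³`. -/
def actB (f : ℤ × ℤ × ℤ → R) : ℤ × ℤ × ℤ → R := fun n =>
  (l₂ * (Z n.2.2)⁻¹ + l₃ * Y n.2.1 - (Q + Q⁻¹) * Y n.2.1 * (Z n.2.2)⁻¹) * f n
    + v * phi Q l₃ (Z n.2.2) * f (n.1, n.2.1 - 1, n.2.2 + 1)
    + v⁻¹ * Q ^ 2 * Y n.2.1 * (Z n.2.2)⁻¹ * phi Q l₂ (Y n.2.1) * f (n.1, n.2.1 + 1, n.2.2 - 1)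

/-- The action of `Δ₂(Λ)` on functions on `ℤ³`. -/
def actL (f : ℤ × ℤ × ℤ → R) : ℤ × ℤ × ℤ → R := fun n =>
  (l₁ - (Q + Q⁻¹) * X n.1) * (Y n.2.1)⁻¹ * (Z n.2.2)⁻¹ * f n
    + X n.1 * actB Q v l₂ l₃ Y Z f n
    + u * phi Q l₂ (Y n.2.1) * (Z n.2.2)⁻¹ * f (n.1 - 1, n.2.1 + 1, n.2.2)
    + u * v * phi Q l₃ (Z n.2.2) * f (n.1 - 1, n.2.1, n.2.2 + 1)
    + Q ^ 2 * phi Q l₁ (X n.1) * X n.1 * (Z n.2.2)⁻¹ *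
      (u⁻¹ * (Y n.2.1)⁻¹ * f (n.1 + 1, n.2.1 - 1, n.2.2)
        + (u * v)⁻¹ * f (n.1 + 1, n.2.1, n.2.2 - 1))

/-- The action of the image of `C` on functions on `ℤ³`. -/
def actC (f : ℤ × ℤ × ℤ → R) : ℤ × ℤ × ℤ → R := fun n =>
  (l₁ * (Z n.2.2)⁻¹ + l₃ * X n.1 - (Q + Q⁻¹) * X n.1 * (Z n.2.2)⁻¹) * f n
    + u * v * Y n.2.1 * phi Q l₃ (Z n.2.2) * f (n.1 - 1, n.2.1, n.2.2 + 1)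
    + Q ^ 2 * (u * v)⁻¹ * X n.1 * (Y n.2.1)⁻¹ * (Z n.2.2)⁻¹ * phi Q l₁ (X n.1)
      * f (n.1 + 1, n.2.1, n.2.2 - 1)
    + v⁻¹ * phi Q l₂ (Y n.2.1) * (Z n.2.2)⁻¹ * ((Q ^ 2 + 1) * X n.1 - Q * l₁)
      * f (n.1, n.2.1 + 1, n.2.2 - 1)
    + u * phi Q l₂ (Y n.2.1) * ((Q ^ 2 + 1) * Y n.2.1 * (Z n.2.2)⁻¹ - Q * l₃ * Y n.2.1)
      * f (n.1 - 1, n.2.1 + 1, n.2.2)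
    - Q ^ 3 * u * v⁻¹ * Y n.2.1 * (Z n.2.2)⁻¹ * phi Q l₂ (Y n.2.1) * phi Q l₂ (Q ^ 2 * Y n.2.1)
      * f (n.1 - 1, n.2.1 + 1 + 1, n.2.2 - 1)

theorem actC_relation (hQ : Q ≠ 0) (hu : u ≠ 0) (hv : v ≠ 0)
    (hX : QGeometric Q X)
    (hY : QGeometric Q Y) (hZ : QGeometric Q Z)
    (f : ℤ × ℤ × ℤ → R) (n : ℤ × ℤ × ℤ) :
    (Q ^ 2 - Q⁻¹ ^ 2) * actC Q u v l₁ l₂ l₃ X Y Z f n +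
      (Q * actA Q u l₁ l₂ X Y (actB Q v l₂ l₃ Y Z f) n
        - Q⁻¹ * actB Q v l₂ l₃ Y Z (actA Q u l₁ l₂ X Y f) n)
    = (Q - Q⁻¹) * (l₁ * l₃ * f n + l₂ * actL Q u v l₁ l₂ l₃ X Y Z f n) := by
  obtain ⟨a, b, c⟩ := n
  have hX' := hX.sub_one hQ
  have hY' := hY.sub_one hQ
  have hZ' := hZ.sub_one hQ
  have := hX.ne_zero a
  have := hY.ne_zero b
  have := hZ.ne_zero c
  simp only [actA, actB, actC, actL, phi, hY.add_one, hY',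
    sub_add_cancel, add_sub_cancel_right]
  generalize X a = x at *
  generalize Y b = y at *
  generalize Z c = z at *
  field_simp
  ring

theorem actA_relation (hQ : Q ≠ 0) (hu : u ≠ 0) (hv : v ≠ 0)
    (hX : QGeometric Q X)
    (hY : QGeometric Q Y) (hZ : QGeometric Q Z)
    (f : ℤ × ℤ × ℤ → R) (n : ℤ × ℤ × ℤ) :
    (Q ^ 2 - Q⁻¹ ^ 2) * actA Q u l₁ l₂ X Y f n +
      (Q * actB Q v l₂ l₃ Y Z (actC Q u v l₁ l₂ l₃ X Y Z f) n
        - Q⁻¹ * actC Q u v l₁ l₂ l₃ X Y Z (actB Q v l₂ l₃ Y Z f) n)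
    = (Q - Q⁻¹) * (l₁ * l₂ * f n + l₃ * actL Q u v l₁ l₂ l₃ X Y Z f n) := by
  obtain ⟨a, b, c⟩ := n
  have hX' := hX.sub_one hQ
  have hY' := hY.sub_one hQ
  have hZ' := hZ.sub_one hQ
  have := hX.ne_zero a
  have := hY.ne_zero b
  have := hZ.ne_zero c
  simp only [actA, actB, actC, actL, phi, hY.add_one, hY', hZ.add_one, hZ',
    sub_add_cancel, add_sub_cancel_right]
  generalize X a = x at *
  generalize Y b = y at *
  generalize Z c = z at *
  field_simp
  ring

theorem actB_relation (hQ : Q ≠ 0) (hu : u ≠ 0) (hv : v ≠ 0)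
    (hX : QGeometric Q X)
    (hY : QGeometric Q Y) (hZ : QGeometric Q Z)
    (f : ℤ × ℤ × ℤ → R) (n : ℤ × ℤ × ℤ) :
    (Q ^ 2 - Q⁻¹ ^ 2) * actB Q v l₂ l₃ Y Z f n +
      (Q * actC Q u v l₁ l₂ l₃ X Y Z (actA Q u l₁ l₂ X Y f) n
        - Q⁻¹ * actA Q u l₁ l₂ X Y (actC Q u v l₁ l₂ l₃ X Y Z f) n)
    = (Q - Q⁻¹) * (l₂ * l₃ * f n + l₁ * actL Q u v l₁ l₂ l₃ X Y Z f n) := by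
  obtain ⟨a, b, c⟩ := n
  have hX' := hX.sub_one hQ
  have hY' := hY.sub_one hQ
  have hZ' := hZ.sub_one hQ
  have := hX.ne_zero a
  have := hY.ne_zero b
  have := hZ.ne_zero c
  simp only [actA, actB, actC, actL, phi, hX.add_one, hX', hY.add_one, hY',
    sub_add_cancel, add_sub_cancel_right]
  generalize X a = x at *
  generalize Y b = y at *
  generalize Z c = z at *
  field_simp
  ring

end act

section tripleRep

variable {F : Type} [Field F] {q : F} (hq0 : q ≠ 0) (hq4 : q ^ 4 ≠ 1)
  {R : Type*} [Field R] [Algebra F R] (u v l₁ l₂ l₃ : R) {X Y Z : ℤ → R}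
  (hu : u ≠ 0) (hv : v ≠ 0) (hX : QGeometric (algebraMap F R q) X)
  (hY : QGeometric (algebraMap F R q) Y) (hZ : QGeometric (algebraMap F R q) Z)

/-- The action of the first tensor factor. -/
noncomputable def rep₁ : UqAlg F q →ₐ[F] Module.End F (ℤ × ℤ × ℤ → R) :=
  uqShiftRep q hq0 hq4 (fun n => X n.1) (1, 0, 0) u l₁ hu (fun n => hX.ne_zero n.1)
    (fun n => by simp [hX.add_one])

/-- The action of the second tensor factor. -/
noncomputable def rep₂ : UqAlg F q →ₐ[F] Module.End F (ℤ × ℤ × ℤ → R) :=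
  uqShiftRep q hq0 hq4 (fun n => Y n.2.1) (0, 1, 0) 1 l₂ one_ne_zero (fun n => hY.ne_zero n.2.1)
    (fun n => by simp [hY.add_one])

/-- The action of the third tensor factor. -/
noncomputable def rep₃ : UqAlg F q →ₐ[F] Module.End F (ℤ × ℤ × ℤ → R) :=
  uqShiftRep q hq0 hq4 (fun n => Z n.2.2) (0, 0, 1) v⁻¹ l₃ (inv_ne_zero hv)
    (fun n => hZ.ne_zero n.2.2) (fun n => by simp [hZ.add_one])

theorem rep₂_commute_rep₃ (a b : UqAlg F q) :
    Commute (rep₂ hq0 hq4 l₂ hY a) (rep₃ hq0 hq4 v l₃ hv hZ b) := by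
  apply uq_commute_of_generators
  rintro x (rfl | rfl | rfl | rfl) y (rfl | rfl | rfl | rfl) <;>
  · simp only [rep₂, rep₃, uqShiftRep, uqLift_E, uqLift_F, uqLift_K, uqLift_Kinv]
    apply weightedShift_commute <;> simp

theorem rep₁_commute_rep₂ (a b : UqAlg F q) :
    Commute (rep₁ hq0 hq4 u l₁ hu hX a) (rep₂ hq0 hq4 l₂ hY b) := by
  apply uq_commute_of_generators
  rintro x (rfl | rfl | rfl | rfl) y (rfl | rfl | rfl | rfl) <;>
  · simp only [rep₁, rep₂, uqShiftRep, uqLift_E, uqLift_F, uqLift_K, uqLift_Kinv]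
    apply weightedShift_commute <;> simp

theorem rep₁_commute_rep₃ (a b : UqAlg F q) :
    Commute (rep₁ hq0 hq4 u l₁ hu hX a) (rep₃ hq0 hq4 v l₃ hv hZ b) := by
  apply uq_commute_of_generators
  rintro x (rfl | rfl | rfl | rfl) y (rfl | rfl | rfl | rfl) <;>
  · simp only [rep₁, rep₃, uqShiftRep, uqLift_E, uqLift_F, uqLift_K, uqLift_Kinv]
    apply weightedShift_commute <;> simp

/-- The representation of `U_q(sl₂)^{⊗3}` on functions on `ℤ³`. -/
noncomputable def tripleRep :
    UqAlg F q ⊗[F] (UqAlg F q ⊗[F] UqAlg F q) →ₐ[F] Module.End F (ℤ × ℤ × ℤ → R) :=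
  Algebra.TensorProduct.lift (rep₁ hq0 hq4 u l₁ hu hX)
    (Algebra.TensorProduct.lift (rep₂ hq0 hq4 l₂ hY) (rep₃ hq0 hq4 v l₃ hv hZ)
      (rep₂_commute_rep₃ hq0 hq4 v l₂ l₃ hv hY hZ))
    (by
      intro a t
      induction t with
      | zero => simp
      | tmul b c =>
        rw [Algebra.TensorProduct.lift_tmul]
        exact (rep₁_commute_rep₂ hq0 hq4 u l₁ l₂ hu hX hY a b).mul_right
          (rep₁_commute_rep₃ hq0 hq4 u v l₁ l₃ hu hv hX hZ a c)
      | add s t hs ht => rw [map_add]; exact hs.add_right ht)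

theorem tripleRep_tmul (a b c : UqAlg F q) :
    tripleRep hq0 hq4 u v l₁ l₂ l₃ hu hv hX hY hZ (a ⊗ₜ (b ⊗ₜ c)) =
      rep₁ hq0 hq4 u l₁ hu hX a * (rep₂ hq0 hq4 l₂ hY b * rep₃ hq0 hq4 v l₃ hv hZ c) := by
  simp [tripleRep]

theorem tripleRep_tmul_one (a : UqAlg F q) :
    tripleRep hq0 hq4 u v l₁ l₂ l₃ hu hv hX hY hZ (a ⊗ₜ 1) = rep₁ hq0 hq4 u l₁ hu hX a := by
  simp [tripleRep]

theorem tripleRep_one_tmul (b c : UqAlg F q) :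
    tripleRep hq0 hq4 u v l₁ l₂ l₃ hu hv hX hY hZ (1 ⊗ₜ (b ⊗ₜ c)) =
      rep₂ hq0 hq4 l₂ hY b * rep₃ hq0 hq4 v l₃ hv hZ c := by
  simp [tripleRep]

theorem algebraMap_sq_sub_one_ne_zero (hq4 : q ^ 4 ≠ 1) : algebraMap F R q ^ 2 - 1 ≠ 0 := by
  rw [← map_pow, ← map_one (algebraMap F R), ← map_sub]
  simp only [ne_eq, map_eq_zero]
  intro h
  exact hq4 (by linear_combination (q ^ 2 + 1) * h)

theorem algebraMap_sq_add_one_ne_zero (hq4 : q ^ 4 ≠ 1) : algebraMap F R q ^ 2 + 1 ≠ 0 := by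
  rw [← map_pow, ← map_one (algebraMap F R), ← map_add]
  simp only [ne_eq, map_eq_zero]
  intro h
  exact hq4 (by linear_combination (q ^ 2 - 1) * h)

theorem uqShiftRep_Lam {I : Type*} [AddCommGroup I] (x : I → R) (s : I)
    (ε l : R) (hε : ε ≠ 0) (hx0 : ∀ n, x n ≠ 0)
    (hx : ∀ n, x (n + s) = algebraMap F R q ^ 2 * x n) :
    uqShiftRep q hq0 hq4 x s ε l hε hx0 hx (UqLam F q) = weightedShift F (fun _ => l) 0 := by
  ext f n
  have := algebraMap_sq_sub_one_ne_zero (R := R) hq4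
  have hQ : algebraMap F R q ≠ 0 := by simpa using hq0
  have := hx0 n
  simp only [uqShiftRep, UqLam, map_add, map_smul, map_mul, uqLift_E, uqLift_F, uqLift_K,
    uqLift_Kinv, LinearMap.add_apply, LinearMap.smul_apply, Pi.add_apply, Pi.smul_apply,
    Algebra.smul_def (R := F) (A := R), Module.End.mul_apply, weightedShift_apply, map_pow,
    map_sub, map_inv₀, add_zero, add_neg_cancel_right]
  field_simp
  ring

theorem comul_Lam (Δ : UqAlg F q →ₐ[F] UqAlg F q ⊗[F] UqAlg F q)
    (hΔE : Δ (UqE F q) = UqE F q ⊗ₜ[F] 1 + UqK F q ⊗ₜ[F] UqE F q)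
    (hΔF : Δ (UqF F q) = UqF F q ⊗ₜ[F] UqKinv F q + 1 ⊗ₜ[F] UqF F q)
    (hΔK : Δ (UqK F q) = UqK F q ⊗ₜ[F] UqK F q)
    (hΔKinv : Δ (UqKinv F q) = UqKinv F q ⊗ₜ[F] UqKinv F q) : Δ (UqLam F q) =
    (q - q⁻¹) ^ 2 • ((UqF F q ⊗ₜ[F] UqKinv F q + 1 ⊗ₜ[F] UqF F q) *
      (UqE F q ⊗ₜ[F] 1 + UqK F q ⊗ₜ[F] UqE F q)) +
    q • (UqK F q ⊗ₜ[F] UqK F q) + q⁻¹ • (UqKinv F q ⊗ₜ[F] UqKinv F q) := by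
  simp [UqLam, hΔE, hΔF, hΔK, hΔKinv]

theorem tripleRep_A (Δ : UqAlg F q →ₐ[F] UqAlg F q ⊗[F] UqAlg F q)
    (hΔE : Δ (UqE F q) = UqE F q ⊗ₜ[F] 1 + UqK F q ⊗ₜ[F] UqE F q)
    (hΔF : Δ (UqF F q) = UqF F q ⊗ₜ[F] UqKinv F q + 1 ⊗ₜ[F] UqF F q)
    (hΔK : Δ (UqK F q) = UqK F q ⊗ₜ[F] UqK F q)
    (hΔKinv : Δ (UqKinv F q) = UqKinv F q ⊗ₜ[F] UqKinv F q) (f : ℤ × ℤ × ℤ → R) :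
    tripleRep hq0 hq4 u v l₁ l₂ l₃ hu hv hX hY hZ
      ((Algebra.TensorProduct.map (AlgHom.id F (UqAlg F q))
          (Algebra.TensorProduct.includeLeft :
            UqAlg F q →ₐ[F] UqAlg F q ⊗[F] UqAlg F q)) (Δ (UqLam F q))) f =
      actA (algebraMap F R q) u l₁ l₂ X Y f := by
  rw [comul_Lam Δ hΔE hΔF hΔK hΔKinv]
  simp only [map_add, map_smul, map_mul, Algebra.TensorProduct.map_tmul, AlgHom.id_apply,
    Algebra.TensorProduct.includeLeft_apply, tripleRep_tmul, tripleRep_tmul_one, map_one,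
    mul_one, one_mul]
  ext ⟨a, b, c⟩
  have := algebraMap_sq_sub_one_ne_zero (R := R) hq4
  have hQ : algebraMap F R q ≠ 0 := by simpa using hq0
  have := hX.ne_zero a
  have := hY.ne_zero b
  simp only [rep₁, rep₂, uqShiftRep, uqLift_E, uqLift_F, uqLift_K,
    uqLift_Kinv, LinearMap.add_apply, LinearMap.smul_apply, Pi.add_apply, Pi.smul_apply,
    Algebra.smul_def (R := F) (A := R), Module.End.mul_apply, weightedShift_apply, map_pow,
    map_sub, map_inv₀, add_zero, Prod.mk_add_mk, Prod.neg_mk, neg_zero, ← sub_eq_add_neg,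
    add_sub_cancel_right, actA, phi, hX.add_one,
    Prod.mk_zero_zero]
  generalize X a = x at *
  generalize Y b = y at *
  field_simp
  ring

theorem tripleRep_B (Δ : UqAlg F q →ₐ[F] UqAlg F q ⊗[F] UqAlg F q)
    (hΔE : Δ (UqE F q) = UqE F q ⊗ₜ[F] 1 + UqK F q ⊗ₜ[F] UqE F q)
    (hΔF : Δ (UqF F q) = UqF F q ⊗ₜ[F] UqKinv F q + 1 ⊗ₜ[F] UqF F q)
    (hΔK : Δ (UqK F q) = UqK F q ⊗ₜ[F] UqK F q)
    (hΔKinv : Δ (UqKinv F q) = UqKinv F q ⊗ₜ[F] UqKinv F q) (f : ℤ × ℤ × ℤ → R) :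
    tripleRep hq0 hq4 u v l₁ l₂ l₃ hu hv hX hY hZ
      ((Algebra.TensorProduct.includeRight :
          UqAlg F q ⊗[F] UqAlg F q →ₐ[F] UqAlg F q ⊗[F] (UqAlg F q ⊗[F] UqAlg F q))
          (Δ (UqLam F q))) f =
      actB (algebraMap F R q) v l₂ l₃ Y Z f := by
  rw [comul_Lam Δ hΔE hΔF hΔK hΔKinv]
  simp only [map_add, map_smul, map_mul, Algebra.TensorProduct.includeRight_apply,
    tripleRep_one_tmul, map_one, mul_one, one_mul]
  ext ⟨a, b, c⟩
  have := algebraMap_sq_sub_one_ne_zero (R := R) hq4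
  have hQ : algebraMap F R q ≠ 0 := by simpa using hq0
  have := hY.ne_zero b
  have := hZ.ne_zero c
  simp only [rep₂, rep₃, uqShiftRep, uqLift_E, uqLift_F, uqLift_K,
    uqLift_Kinv, LinearMap.add_apply, LinearMap.smul_apply, Pi.add_apply, Pi.smul_apply,
    Algebra.smul_def (R := F) (A := R), Module.End.mul_apply, weightedShift_apply, map_pow,
    map_sub, map_inv₀, add_zero, Prod.mk_add_mk, Prod.neg_mk, neg_zero, ← sub_eq_add_neg,
    add_sub_cancel_right, actB, phi, hY.add_one]
  generalize Y b = y at *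
  generalize Z c = z at *
  field_simp
  ring

theorem tripleRep_L (Δ : UqAlg F q →ₐ[F] UqAlg F q ⊗[F] UqAlg F q)
    (hΔE : Δ (UqE F q) = UqE F q ⊗ₜ[F] 1 + UqK F q ⊗ₜ[F] UqE F q)
    (hΔF : Δ (UqF F q) = UqF F q ⊗ₜ[F] UqKinv F q + 1 ⊗ₜ[F] UqF F q)
    (hΔK : Δ (UqK F q) = UqK F q ⊗ₜ[F] UqK F q)
    (hΔKinv : Δ (UqKinv F q) = UqKinv F q ⊗ₜ[F] UqKinv F q) (f : ℤ × ℤ × ℤ → R) :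
    tripleRep hq0 hq4 u v l₁ l₂ l₃ hu hv hX hY hZ
      ((Algebra.TensorProduct.map (AlgHom.id F (UqAlg F q)) Δ) (Δ (UqLam F q))) f =
      actL (algebraMap F R q) u v l₁ l₂ l₃ X Y Z f := by
  rw [comul_Lam Δ hΔE hΔF hΔK hΔKinv]
  simp only [map_add, map_smul, map_mul, Algebra.TensorProduct.map_tmul, AlgHom.id_apply,
    hΔE, hΔF, hΔK, hΔKinv, TensorProduct.tmul_add,
    tripleRep_tmul, tripleRep_tmul_one, map_one,
    mul_one, one_mul]
  ext ⟨a, b, c⟩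
  have := algebraMap_sq_sub_one_ne_zero (R := R) hq4
  have hQ : algebraMap F R q ≠ 0 := by simpa using hq0
  have := hX.ne_zero a
  have := hY.ne_zero b
  have := hZ.ne_zero c
  simp only [rep₁, rep₂, rep₃, uqShiftRep, uqLift_E, uqLift_F, uqLift_K,
    uqLift_Kinv, LinearMap.add_apply, LinearMap.smul_apply, Pi.add_apply, Pi.smul_apply,
    Algebra.smul_def (R := F) (A := R), Module.End.mul_apply, weightedShift_apply, map_pow,
    map_sub, map_inv₀, add_zero, Prod.mk_add_mk, Prod.neg_mk, neg_zero, ← sub_eq_add_neg,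
    add_sub_cancel_right, actL, actB, phi, hX.add_one, hY.add_one,
    Prod.mk_zero_zero]
  generalize X a = x at *
  generalize Y b = y at *
  generalize Z c = z at *
  field_simp
  ring

theorem tripleRep_gamma (Δ : UqAlg F q →ₐ[F] UqAlg F q ⊗[F] UqAlg F q)
    (hΔE : Δ (UqE F q) = UqE F q ⊗ₜ[F] 1 + UqK F q ⊗ₜ[F] UqE F q)
    (hΔF : Δ (UqF F q) = UqF F q ⊗ₜ[F] UqKinv F q + 1 ⊗ₜ[F] UqF F q)
    (hΔK : Δ (UqK F q) = UqK F q ⊗ₜ[F] UqK F q)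
    (hΔKinv : Δ (UqKinv F q) = UqKinv F q ⊗ₜ[F] UqKinv F q) (f : ℤ × ℤ × ℤ → R)
    (n : ℤ × ℤ × ℤ) :
    tripleRep hq0 hq4 u v l₁ l₂ l₃ hu hv hX hY hZ
      (UqLam F q ⊗ₜ[F] ((1 : UqAlg F q) ⊗ₜ[F] UqLam F q) +
        ((1 : UqAlg F q) ⊗ₜ[F] (UqLam F q ⊗ₜ[F] (1 : UqAlg F q))) *
          (Algebra.TensorProduct.map (AlgHom.id F (UqAlg F q)) Δ) (Δ (UqLam F q))) f n =
      l₁ * l₃ * f n + l₂ * actL (algebraMap F R q) u v l₁ l₂ l₃ X Y Z f n := by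
  rw [map_add, map_mul, tripleRep_tmul, tripleRep_tmul]
  simp only [LinearMap.add_apply, Module.End.mul_apply,
    tripleRep_L hq0 hq4 u v l₁ l₂ l₃ hu hv hX hY hZ Δ hΔE hΔF hΔK hΔKinv]
  simp [rep₁, rep₂, rep₃, uqShiftRep_Lam, weightedShift_apply, mul_assoc]

end tripleRep

section awRep

variable {F : Type} [Field F] {q : F} {R : Type*} [Field R] [Algebra F R]
  {u v l₁ l₂ l₃ : R} {X Y Z : ℤ → R} {π : AWAlg F q →ₐ[F] Module.End F (ℤ × ℤ × ℤ → R)}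

theorem qsub_ne_zero (hq0 : q ≠ 0) (hq4 : q ^ 4 ≠ 1) :
    algebraMap F R q - (algebraMap F R q)⁻¹ ≠ 0 := by
  have hQ : algebraMap F R q ≠ 0 := by simpa using hq0
  rw [show algebraMap F R q - (algebraMap F R q)⁻¹ =
    (algebraMap F R q ^ 2 - 1) * (algebraMap F R q)⁻¹ by field_simp]
  exact mul_ne_zero (algebraMap_sq_sub_one_ne_zero hq4) (inv_ne_zero hQ)

theorem qsub_sq_ne_zero (hq0 : q ≠ 0) (hq4 : q ^ 4 ≠ 1) :
    algebraMap F R q ^ 2 - (algebraMap F R q)⁻¹ ^ 2 ≠ 0 := by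
  have hQ : algebraMap F R q ≠ 0 := by simpa using hq0
  rw [show algebraMap F R q ^ 2 - (algebraMap F R q)⁻¹ ^ 2 = (algebraMap F R q ^ 2 - 1) *
    (algebraMap F R q ^ 2 + 1) * ((algebraMap F R q)⁻¹ ^ 2) by field_simp; ring]
  exact mul_ne_zero (mul_ne_zero (algebraMap_sq_sub_one_ne_zero hq4)
    (algebraMap_sq_add_one_ne_zero hq4)) (pow_ne_zero 2 (inv_ne_zero hQ))

theorem qsub_mul_qadd_mul (hq0 : q ≠ 0) (hq4 : q ^ 4 ≠ 1) (c t : R) :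
    (algebraMap F R q - (algebraMap F R q)⁻¹) * ((algebraMap F R q + (algebraMap F R q)⁻¹) *
      (c + (algebraMap F R q ^ 2 - (algebraMap F R q)⁻¹ ^ 2)⁻¹ * t)) =
    (algebraMap F R q ^ 2 - (algebraMap F R q)⁻¹ ^ 2) * c + t := by
  rw [← mul_assoc, show (algebraMap F R q - (algebraMap F R q)⁻¹) *
    (algebraMap F R q + (algebraMap F R q)⁻¹) =
    algebraMap F R q ^ 2 - (algebraMap F R q)⁻¹ ^ 2 by ring, mul_add,
    mul_inv_cancel_left₀ (qsub_sq_ne_zero hq0 hq4)]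

theorem awRep_C (hq0 : q ≠ 0) (hq4 : q ^ 4 ≠ 1) (hu : u ≠ 0) (hv : v ≠ 0)
    (hX : QGeometric (algebraMap F R q) X) (hY : QGeometric (algebraMap F R q) Y)
    (hZ : QGeometric (algebraMap F R q) Z)
    (hA : ∀ f, π (AWA F q) f = actA (algebraMap F R q) u l₁ l₂ X Y f)
    (hB : ∀ f, π (AWB F q) f = actB (algebraMap F R q) v l₂ l₃ Y Z f)
    (hG : ∀ f n, π (AWgamma F q) f n = l₁ * l₃ * f n
      + l₂ * actL (algebraMap F R q) u v l₁ l₂ l₃ X Y Z f n) (f : ℤ × ℤ × ℤ → R) :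
    π (AWC F q) f = actC (algebraMap F R q) u v l₁ l₂ l₃ X Y Z f := by
  ext n
  have hQ : algebraMap F R q ≠ 0 := by simpa using hq0
  have h3 := hG f n
  have h4 := actC_relation (algebraMap F R q) u v l₁ l₂ l₃ X Y Z hQ hu hv hX hY hZ f n
  simp only [AWgamma, map_smul, map_add, map_sub, map_mul, LinearMap.smul_apply,
    LinearMap.add_apply, LinearMap.sub_apply, Module.End.mul_apply, hA, hB, Pi.add_apply,
    Pi.smul_apply, Pi.sub_apply, Algebra.smul_def (R := F) (A := R), map_pow, map_inv₀] at h3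
  rw [← h3, qsub_mul_qadd_mul hq0 hq4] at h4
  exact (mul_left_cancel₀ (qsub_sq_ne_zero hq0 hq4) (add_right_cancel h4)).symm

theorem awRep_alpha (hq0 : q ≠ 0) (hq4 : q ^ 4 ≠ 1) (hu : u ≠ 0) (hv : v ≠ 0)
    (hX : QGeometric (algebraMap F R q) X) (hY : QGeometric (algebraMap F R q) Y)
    (hZ : QGeometric (algebraMap F R q) Z)
    (hA : ∀ f, π (AWA F q) f = actA (algebraMap F R q) u l₁ l₂ X Y f)
    (hB : ∀ f, π (AWB F q) f = actB (algebraMap F R q) v l₂ l₃ Y Z f)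
    (hC : ∀ f, π (AWC F q) f = actC (algebraMap F R q) u v l₁ l₂ l₃ X Y Z f)
    (f : ℤ × ℤ × ℤ → R) (n : ℤ × ℤ × ℤ) :
    π (AWalpha F q) f n = l₁ * l₂ * f n
      + l₃ * actL (algebraMap F R q) u v l₁ l₂ l₃ X Y Z f n := by
  have hQ : algebraMap F R q ≠ 0 := by simpa using hq0
  apply mul_left_cancel₀ (qsub_ne_zero (R := R) hq0 hq4)
  rw [← actA_relation (algebraMap F R q) u v l₁ l₂ l₃ X Y Z hQ hu hv hX hY hZ f n]
  simp only [AWalpha, map_smul, map_add, map_sub, map_mul, LinearMap.smul_apply,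
    LinearMap.add_apply, LinearMap.sub_apply, Module.End.mul_apply, hA, hB, hC, Pi.add_apply,
    Pi.smul_apply, Pi.sub_apply, Algebra.smul_def (R := F) (A := R), map_pow, map_inv₀]
  rw [qsub_mul_qadd_mul hq0 hq4]

theorem awRep_beta (hq0 : q ≠ 0) (hq4 : q ^ 4 ≠ 1) (hu : u ≠ 0) (hv : v ≠ 0)
    (hX : QGeometric (algebraMap F R q) X) (hY : QGeometric (algebraMap F R q) Y)
    (hZ : QGeometric (algebraMap F R q) Z)
    (hA : ∀ f, π (AWA F q) f = actA (algebraMap F R q) u l₁ l₂ X Y f)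
    (hB : ∀ f, π (AWB F q) f = actB (algebraMap F R q) v l₂ l₃ Y Z f)
    (hC : ∀ f, π (AWC F q) f = actC (algebraMap F R q) u v l₁ l₂ l₃ X Y Z f)
    (f : ℤ × ℤ × ℤ → R) (n : ℤ × ℤ × ℤ) :
    π (AWbeta F q) f n = l₂ * l₃ * f n
      + l₁ * actL (algebraMap F R q) u v l₁ l₂ l₃ X Y Z f n := by
  have hQ : algebraMap F R q ≠ 0 := by simpa using hq0
  apply mul_left_cancel₀ (qsub_ne_zero (R := R) hq0 hq4)
  rw [← actB_relation (algebraMap F R q) u v l₁ l₂ l₃ X Y Z hQ hu hv hX hY hZ f n]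
  simp only [AWbeta, map_smul, map_add, map_sub, map_mul, LinearMap.smul_apply,
    LinearMap.add_apply, LinearMap.sub_apply, Module.End.mul_apply, hA, hB, hC, Pi.add_apply,
    Pi.smul_apply, Pi.sub_apply, Algebra.smul_def (R := F) (A := R), map_pow, map_inv₀]
  rw [qsub_mul_qadd_mul hq0 hq4]

end awRep

section spanning

/-- The ordered monomial `A ^ i * B ^ j * C ^ k * a ^ r * b ^ s * c ^ t`. -/
def orderedMonomial {T : Type*} [Monoid T] (A B C a b c : T) (e : Fin 6 → ℕ) : T :=
  A ^ e 0 * (B ^ e 1 * (C ^ e 2 * (a ^ e 3 * (b ^ e 4 * c ^ e 5))))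

variable {F : Type*} [Field F] {T : Type*} [Ring T] [Algebra F T] {A B C a b c : T}

/-- The span of the ordered monomials of degree at most `n` in `A`, `B`, `C`. -/
def filteredSpan (F : Type*) [Field F] {T : Type*} [Ring T] [Algebra F T] (A B C a b c : T)
    (n : ℕ) : Submodule F T :=
  Submodule.span F (orderedMonomial A B C a b c '' {e | e 0 + e 1 + e 2 ≤ n})

theorem orderedMonomial_mem {n : ℕ} {e : Fin 6 → ℕ} (he : e 0 + e 1 + e 2 ≤ n) :
    orderedMonomial A B C a b c e ∈ filteredSpan F A B C a b c n :=
  Submodule.subset_span ⟨e, he, rfl⟩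

theorem filteredSpan_mono : Monotone (filteredSpan F A B C a b c) := fun _ _ h =>
  Submodule.span_mono (Set.image_mono fun _ he => le_trans he h)

theorem mul_mem_of_forall_monomial {n : ℕ} {W : Submodule F T} {x : T}
    (h : ∀ e : Fin 6 → ℕ, e 0 + e 1 + e 2 ≤ n → x * orderedMonomial A B C a b c e ∈ W) :
    ∀ y ∈ filteredSpan F A B C a b c n, x * y ∈ W := by
  intro y hy
  refine Submodule.span_induction ?_ ?_ ?_ ?_ hy
  · rintro _ ⟨e, he, rfl⟩
    exact h e he
  · simp
  · intro y z _ _ hy hz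
    rw [mul_add]
    exact W.add_mem hy hz
  · intro r y _ hy
    rw [mul_smul_comm]
    exact W.smul_mem r hy

theorem mul_filteredSpan_a (ha : ∀ x, Commute a x) (n : ℕ) :
    ∀ y ∈ filteredSpan F A B C a b c n, a * y ∈ filteredSpan F A B C a b c n := by
  refine mul_mem_of_forall_monomial fun e he => ?_
  convert orderedMonomial_mem (F := F) (A := A) (B := B) (C := C) (a := a) (b := b) (c := c)
    (n := n) (e := ![e 0, e 1, e 2, e 3 + 1, e 4, e 5]) he using 1
  simp only [orderedMonomial]
  simp [pow_succ', (ha _).left_comm, mul_assoc]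

theorem mul_filteredSpan_b (hb : ∀ x, Commute b x) (n : ℕ) :
    ∀ y ∈ filteredSpan F A B C a b c n, b * y ∈ filteredSpan F A B C a b c n := by
  refine mul_mem_of_forall_monomial fun e he => ?_
  convert orderedMonomial_mem (F := F) (A := A) (B := B) (C := C) (a := a) (b := b) (c := c)
    (n := n) (e := ![e 0, e 1, e 2, e 3, e 4 + 1, e 5]) he using 1
  simp only [orderedMonomial]
  simp [pow_succ', (hb _).left_comm, mul_assoc]

theorem mul_filteredSpan_c (hc : ∀ x, Commute c x) (n : ℕ) :
    ∀ y ∈ filteredSpan F A B C a b c n, c * y ∈ filteredSpan F A B C a b c n := by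
  refine mul_mem_of_forall_monomial fun e he => ?_
  convert orderedMonomial_mem (F := F) (A := A) (B := B) (C := C) (a := a) (b := b) (c := c)
    (n := n) (e := ![e 0, e 1, e 2, e 3, e 4, e 5 + 1]) he using 1
  simp only [orderedMonomial]
  simp [pow_succ', (hc _).left_comm]

theorem mul_filteredSpan_A (n : ℕ) :
    ∀ y ∈ filteredSpan F A B C a b c n, A * y ∈ filteredSpan F A B C a b c (n + 1) := by
  refine mul_mem_of_forall_monomial fun e he => ?_
  convert orderedMonomial_mem (F := F) (A := A) (B := B) (C := C) (a := a) (b := b) (c := c)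
    (n := n + 1) (e := ![e 0 + 1, e 1, e 2, e 3, e 4, e 5]) (by simp; omega) using 1
  simp [orderedMonomial, pow_succ', mul_assoc]

theorem orderedMonomial_eq_A_mul {e : Fin 6 → ℕ} {i : ℕ} (h : e 0 = i + 1) :
    orderedMonomial A B C a b c e =
      A * orderedMonomial A B C a b c ![i, e 1, e 2, e 3, e 4, e 5] := by
  simp [orderedMonomial, h, pow_succ', mul_assoc]

theorem orderedMonomial_eq_B_mul {e : Fin 6 → ℕ} {j : ℕ} (h0 : e 0 = 0) (h : e 1 = j + 1) :
    orderedMonomial A B C a b c e =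
      B * orderedMonomial A B C a b c ![0, j, e 2, e 3, e 4, e 5] := by
  simp [orderedMonomial, h0, h, pow_succ', mul_assoc]

theorem mul_filteredSpan_BC (ha : ∀ x, Commute a x) (hb : ∀ x, Commute b x)
    (hc : ∀ x, Commute c x) {x₀ x₁ x₂ y₀ y₁ y₂ z₀ z₁ z₂ : F}
    (hBA : B * A = x₀ • (A * B) + x₁ • c + x₂ • C)
    (hCA : C * A = y₀ • (A * C) + y₁ • b + y₂ • B)
    (hCB : C * B = z₀ • (B * C) + z₁ • a + z₂ • A) (n : ℕ) :
    (∀ y ∈ filteredSpan F A B C a b c n, B * y ∈ filteredSpan F A B C a b c (n + 1)) ∧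
    (∀ y ∈ filteredSpan F A B C a b c n, C * y ∈ filteredSpan F A B C a b c (n + 1)) := by
  induction n with
  | zero =>
    constructor
    · refine mul_mem_of_forall_monomial fun e he => ?_
      convert orderedMonomial_mem (F := F) (A := A) (B := B) (C := C) (a := a) (b := b) (c := c)
        (n := 0 + 1) (e := ![0, 1, 0, e 3, e 4, e 5]) (by simp) using 1
      simp [orderedMonomial, show e 0 = 0 by omega, show e 1 = 0 by omega, show e 2 = 0 by omega]
    · refine mul_mem_of_forall_monomial fun e he => ?_
      convert orderedMonomial_mem (F := F) (A := A) (B := B) (C := C) (a := a) (b := b) (c := c)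
        (n := 0 + 1) (e := ![0, 0, 1, e 3, e 4, e 5]) (by simp) using 1
      simp [orderedMonomial, show e 0 = 0 by omega, show e 1 = 0 by omega, show e 2 = 0 by omega]
  | succ n ih =>
    obtain ⟨ihB, ihC⟩ := ih
    have up {m : ℕ} {y : T} (h : y ∈ filteredSpan F A B C a b c m) (hm : m ≤ n + 2) :
      y ∈ filteredSpan F A B C a b c (n + 1 + 1) := filteredSpan_mono hm h
    have hB : ∀ y ∈ filteredSpan F A B C a b c (n + 1),
        B * y ∈ filteredSpan F A B C a b c (n + 1 + 1) := by
      refine mul_mem_of_forall_monomial fun e he => ?_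
      rcases h : e 0 with _ | i
      · convert orderedMonomial_mem (F := F) (A := A) (B := B) (C := C) (a := a) (b := b) (c := c)
          (n := n + 1 + 1) (e := ![0, e 1 + 1, e 2, e 3, e 4, e 5]) (by simp; omega) using 1
        simp [orderedMonomial, h, pow_succ', mul_assoc]
      · rw [orderedMonomial_eq_A_mul h]
        have hw : orderedMonomial A B C a b c ![i, e 1, e 2, e 3, e 4, e 5] ∈
          filteredSpan F A B C a b c n := orderedMonomial_mem (by simp; omega)
        generalize orderedMonomial A B C a b c ![i, e 1, e 2, e 3, e 4, e 5] = w at hw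
        rw [← mul_assoc, hBA]
        simp only [add_mul, smul_mul_assoc, mul_assoc]
        exact add_mem (add_mem (Submodule.smul_mem _ _ (mul_filteredSpan_A _ _ (ihB _ hw)))
          (Submodule.smul_mem _ _ (up (mul_filteredSpan_c hc _ _ hw) (by omega))))
          (Submodule.smul_mem _ _ (up (ihC _ hw) (by omega)))
    refine ⟨hB, mul_mem_of_forall_monomial fun e he => ?_⟩
    rcases h : e 0 with _ | i
    · rcases h' : e 1 with _ | j
      · convert orderedMonomial_mem (F := F) (A := A) (B := B) (C := C) (a := a) (b := b) (c := c)
          (n := n + 1 + 1) (e := ![0, 0, e 2 + 1, e 3, e 4, e 5]) (by simp; omega) using 1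
        simp [orderedMonomial, h, h', pow_succ', mul_assoc]
      · rw [orderedMonomial_eq_B_mul h h']
        have hw : orderedMonomial A B C a b c ![0, j, e 2, e 3, e 4, e 5] ∈
          filteredSpan F A B C a b c n := orderedMonomial_mem (by simp; omega)
        generalize orderedMonomial A B C a b c ![0, j, e 2, e 3, e 4, e 5] = w at hw
        rw [← mul_assoc, hCB]
        simp only [add_mul, smul_mul_assoc, mul_assoc]
        exact add_mem (add_mem (Submodule.smul_mem _ _ (hB _ (ihC _ hw)))
          (Submodule.smul_mem _ _ (up (mul_filteredSpan_a ha _ _ hw) (by omega))))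
          (Submodule.smul_mem _ _ (up (mul_filteredSpan_A _ _ hw) (by omega)))
    · rw [orderedMonomial_eq_A_mul h]
      have hw : orderedMonomial A B C a b c ![i, e 1, e 2, e 3, e 4, e 5] ∈
        filteredSpan F A B C a b c n := orderedMonomial_mem (by simp; omega)
      generalize orderedMonomial A B C a b c ![i, e 1, e 2, e 3, e 4, e 5] = w at hw
      rw [← mul_assoc, hCA]
      simp only [add_mul, smul_mul_assoc, mul_assoc]
      exact add_mem (add_mem (Submodule.smul_mem _ _ (mul_filteredSpan_A _ _ (ihC _ hw)))
        (Submodule.smul_mem _ _ (up (mul_filteredSpan_b hb _ _ hw) (by omega))))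
        (Submodule.smul_mem _ _ (up (ihB _ hw) (by omega)))

/-- A PBW-type spanning statement: if `A`, `B`, `C` generate, can be reordered modulo lower terms
and `a`, `b`, `c` are central, then the ordered monomials span. -/
theorem span_orderedMonomial_eq_top (ha : ∀ x, Commute a x) (hb : ∀ x, Commute b x)
    (hc : ∀ x, Commute c x) {x₀ x₁ x₂ y₀ y₁ y₂ z₀ z₁ z₂ : F}
    (hBA : B * A = x₀ • (A * B) + x₁ • c + x₂ • C)
    (hCA : C * A = y₀ • (A * C) + y₁ • b + y₂ • B)
    (hCB : C * B = z₀ • (B * C) + z₁ • a + z₂ • A)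
    (hgen : Algebra.adjoin F {A, B, C} = ⊤) :
    Submodule.span F (Set.range (orderedMonomial A B C a b c)) = ⊤ := by
  set W := Submodule.span F (Set.range (orderedMonomial A B C a b c))
  have hsub (n : ℕ) : filteredSpan F A B C a b c n ≤ W :=
    Submodule.span_mono (Set.image_subset_range _ _)
  have hBC := mul_filteredSpan_BC ha hb hc hBA hCA hCB
  have hmul (x : T) (hx : ∀ n, ∀ y ∈ filteredSpan F A B C a b c n,
      x * y ∈ filteredSpan F A B C a b c (n + 1)) : ∀ y ∈ W, x * y ∈ W := by
    intro y hy
    refine Submodule.span_induction ?_ ?_ ?_ ?_ hy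
    · rintro _ ⟨e, rfl⟩
      exact hsub _ (hx _ _ (orderedMonomial_mem le_rfl))
    · simp
    · intro y z _ _ hy hz
      rw [mul_add]
      exact W.add_mem hy hz
    · intro r y _ hy
      rw [mul_smul_comm]
      exact W.smul_mem r hy
  have hall (x : T) : ∀ y ∈ W, x * y ∈ W := by
    have hx : x ∈ Algebra.adjoin F {A, B, C} := by rw [hgen]; trivial
    induction hx using Algebra.adjoin_induction with
    | mem x hx =>
      obtain rfl | rfl | rfl := hx
      · exact hmul _ mul_filteredSpan_A
      · exact hmul _ fun n => (hBC n).1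
      · exact hmul _ fun n => (hBC n).2
    | algebraMap r =>
      intro y hy
      rw [← Algebra.smul_def]
      exact W.smul_mem r hy
    | add x z _ _ hx hz =>
      intro y hy
      rw [add_mul]
      exact W.add_mem (hx y hy) (hz y hy)
    | mul x z _ _ hx hz =>
      intro y hy
      rw [mul_assoc]
      exact hx _ (hz y hy)
  have h1 : (1 : T) ∈ W := Submodule.subset_span ⟨0, by simp [orderedMonomial]⟩
  rw [eq_top_iff]
  intro x _
  simpa using hall x 1 h1

end spanning

section awSpanning

variable {F : Type} [Field F] {q : F}

theorem aw_adjoin_eq_top : Algebra.adjoin F {AWA F q, AWB F q, AWC F q} = ⊤ := by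
  rw [eq_top_iff]
  rintro x -
  obtain ⟨y, rfl⟩ := RingQuot.mkAlgHom_surjective F (AWRel F q) x
  induction y using FreeAlgebra.induction with
  | grade0 r => rw [AlgHom.commutes]; exact Subalgebra.algebraMap_mem _ r
  | grade1 g =>
    apply Algebra.subset_adjoin
    cases g <;> simp [AWA, AWB, AWC]
  | mul a b ha hb => rw [map_mul]; exact mul_mem ha hb
  | add a b ha hb => rw [map_add]; exact add_mem ha hb

theorem aw_commute_of_generators {z : AWAlg F q} (hA : Commute z (AWA F q))
    (hB : Commute z (AWB F q)) (hC : Commute z (AWC F q)) (x : AWAlg F q) : Commute z x := by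
  have hx : x ∈ Algebra.adjoin F {AWA F q, AWB F q, AWC F q} := by
    rw [aw_adjoin_eq_top]; trivial
  induction hx using Algebra.adjoin_induction with
  | mem x hx => obtain rfl | rfl | rfl := hx <;> assumption
  | algebraMap r => exact Algebra.commute_algebraMap_right r _
  | add y z _ _ hy hz => exact hy.add_right hz
  | mul y z _ _ hy hz => exact hy.mul_right hz

theorem AWalpha_commute (x : AWAlg F q) : Commute (AWalpha F q) x := by
  have h (g : AWGen) := RingQuot.mkAlgHom_rel F (AWRel.Acen (q := q) (F := F) g)
  have e : AWalpha F q = (q + q⁻¹) • RingQuot.mkAlgHom F (AWRel F q) (awNA F q) := by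
    simp [AWalpha, awNA, AWA, AWB, AWC]
  simp only [map_mul] at h
  rw [e]
  exact Commute.smul_left (aw_commute_of_generators (h _) (h _) (h _) x) _

theorem AWbeta_commute (x : AWAlg F q) : Commute (AWbeta F q) x := by
  have h (g : AWGen) := RingQuot.mkAlgHom_rel F (AWRel.Bcen (q := q) (F := F) g)
  have e : AWbeta F q = (q + q⁻¹) • RingQuot.mkAlgHom F (AWRel F q) (awNB F q) := by
    simp [AWbeta, awNB, AWA, AWB, AWC]
  simp only [map_mul] at h
  rw [e]
  exact Commute.smul_left (aw_commute_of_generators (h _) (h _) (h _) x) _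

theorem AWgamma_commute (x : AWAlg F q) : Commute (AWgamma F q) x := by
  have h (g : AWGen) := RingQuot.mkAlgHom_rel F (AWRel.Ccen (q := q) (F := F) g)
  have e : AWgamma F q = (q + q⁻¹) • RingQuot.mkAlgHom F (AWRel F q) (awNC F q) := by
    simp [AWgamma, awNC, AWA, AWB, AWC]
  simp only [map_mul] at h
  rw [e]
  exact Commute.smul_left (aw_commute_of_generators (h _) (h _) (h _) x) _

theorem AWB_mul_AWA (hq0 : q ≠ 0) (hq4 : q ^ 4 ≠ 1) :
    AWB F q * AWA F q = q ^ 2 • (AWA F q * AWB F q) + (-(q ^ 2 - 1)) • AWgamma F q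
      + (q * (q ^ 2 - q⁻¹ ^ 2)) • AWC F q := by
  have h : q ^ 4 - 1 ≠ 0 := sub_ne_zero.2 hq4
  rw [AWgamma]
  match_scalars <;> field_simp <;> ring

theorem AWC_mul_AWA (hq0 : q ≠ 0) (hq4 : q ^ 4 ≠ 1) :
    AWC F q * AWA F q = q⁻¹ ^ 2 • (AWA F q * AWC F q) + (1 - q⁻¹ ^ 2) • AWbeta F q
      + (-q⁻¹ * (q ^ 2 - q⁻¹ ^ 2)) • AWB F q := by
  have h : q ^ 4 - 1 ≠ 0 := sub_ne_zero.2 hq4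
  rw [AWbeta]
  match_scalars <;> field_simp <;> ring

theorem AWC_mul_AWB (hq0 : q ≠ 0) (hq4 : q ^ 4 ≠ 1) :
    AWC F q * AWB F q = q ^ 2 • (AWB F q * AWC F q) + (-(q ^ 2 - 1)) • AWalpha F q
      + (q * (q ^ 2 - q⁻¹ ^ 2)) • AWA F q := by
  have h : q ^ 4 - 1 ≠ 0 := sub_ne_zero.2 hq4
  rw [AWalpha]
  match_scalars <;> field_simp <;> ring

theorem aw_span_orderedMonomial (hq0 : q ≠ 0) (hq4 : q ^ 4 ≠ 1) :
    Submodule.span F (Set.range (orderedMonomial (AWA F q) (AWB F q) (AWC F q) (AWalpha F q)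
      (AWbeta F q) (AWgamma F q))) = ⊤ :=
  span_orderedMonomial_eq_top AWalpha_commute AWbeta_commute AWgamma_commute
    (AWB_mul_AWA hq0 hq4) (AWC_mul_AWA hq0 hq4) (AWC_mul_AWB hq0 hq4) aw_adjoin_eq_top

end awSpanning

section leading

open HahnSeries

variable {Γ : Type*} [AddCommGroup Γ] [LinearOrder Γ] {F : Type*} [Field F]

/-- All exponents of `x` have image at least `m` under `w`. -/
def WeightGE (w : Γ →+ ℤ) (m : ℤ) (x : HahnSeries Γ F) : Prop :=
  ∀ γ, x.coeff γ ≠ 0 → m ≤ w γ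

variable {w : Γ →+ ℤ} {m m' : ℤ} {x y : HahnSeries Γ F} {g g' : Γ}

theorem WeightGE.mono (hx : WeightGE w m x) (h : m' ≤ m) : WeightGE w m' x :=
  fun γ hγ => h.trans (hx γ hγ)

theorem WeightGE.add (hx : WeightGE w m x) (hy : WeightGE w m y) : WeightGE w m (x + y) := by
  intro γ hγ
  by_cases h : x.coeff γ = 0
  · exact hy γ (by simpa [h] using hγ)
  · exact hx γ h

theorem WeightGE.neg (hx : WeightGE w m x) : WeightGE w m (-x) :=
  fun γ hγ => hx γ (by simpa using hγ)

theorem WeightGE.sub (hx : WeightGE w m x) (hy : WeightGE w m y) : WeightGE w m (x - y) := by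
  rw [sub_eq_add_neg]
  exact hx.add hy.neg

theorem weightGE_of_orderTop (hw : Monotone w) (hx : x.orderTop = g) : WeightGE w (w g) x :=
  fun _ hγ => hw (WithTop.coe_le_coe.1 (hx ▸ orderTop_le_of_coeff_ne_zero hγ))

theorem orderTop_add_of_weightGE (hw : Monotone w) (hx : x.orderTop = g)
    (hy : WeightGE w (w g + 1) y) : (x + y).orderTop = g := by
  rw [orderTop_add_eq_left, hx]
  by_contra h
  rw [hx, not_lt] at h
  induction hz : y.orderTop using WithTop.recTopCoe with
  | top => simp [hz] at h
  | coe γ =>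
    rw [hz] at h
    have h1 := hy γ (coeff_orderTop_ne hz)
    have h2 := hw (WithTop.coe_le_coe.1 h)
    omega

/-- Every value of `f` has order `g`. -/
def HasLead (f : ℤ × ℤ × ℤ → HahnSeries Γ F) (g : Γ) : Prop := ∀ n, (f n).orderTop = g

/-- Parameters of the representation on functions on `ℤ³` whose orders are such that each of
`actA`, `actB`, `actC`, `actL` has a unique dominant term. -/
structure LeadingData (w : Γ →+ ℤ) (u v l₁ l₂ l₃ : HahnSeries Γ F) (X Y Z : ℤ → HahnSeries Γ F)
    (ou ov ox oz o₁ o₂ o₃ : Γ) : Prop where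
  mono : Monotone w
  order_u : u.orderTop = ou
  order_v : v.orderTop = ov
  order_X (a : ℤ) : (X a).orderTop = ox
  order_Y (b : ℤ) : (Y b).orderTop = ((0 : Γ) : WithTop Γ)
  order_Z (c : ℤ) : (Z c).orderTop = oz
  order_l₁ : l₁.orderTop = o₁
  order_l₂ : l₂.orderTop = o₂
  order_l₃ : l₃.orderTop = o₃
  weight_ou : w ou = 0
  weight_ov : w ov = -1
  weight_ox : w ox = -1
  weight_oz : w oz = -1
  weight_o₁ : w o₁ = 0
  weight_o₂ : w o₂ = 0
  weight_o₃ : w o₃ = 0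

namespace LeadingData

variable {u v l₁ l₂ l₃ : HahnSeries Γ F} {X Y Z : ℤ → HahnSeries Γ F}
  {ou ov ox oz o₁ o₂ o₃ : Γ}

theorem weight_u
    (h : LeadingData w u v l₁ l₂ l₃ X Y Z ou ov ox oz o₁ o₂ o₃) : WeightGE w 0 u :=
  (weightGE_of_orderTop h.mono h.order_u).mono h.weight_ou.ge

theorem weight_v
    (h : LeadingData w u v l₁ l₂ l₃ X Y Z ou ov ox oz o₁ o₂ o₃) : WeightGE w (-1) v :=
  (weightGE_of_orderTop h.mono h.order_v).mono h.weight_ov.ge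

theorem weight_X
    (h : LeadingData w u v l₁ l₂ l₃ X Y Z ou ov ox oz o₁ o₂ o₃)
    (a : ℤ) : WeightGE w (-1) (X a) :=
  (weightGE_of_orderTop h.mono (h.order_X a)).mono h.weight_ox.ge

theorem weight_Z
    (h : LeadingData w u v l₁ l₂ l₃ X Y Z ou ov ox oz o₁ o₂ o₃)
    (c : ℤ) : WeightGE w (-1) (Z c) :=
  (weightGE_of_orderTop h.mono (h.order_Z c)).mono h.weight_oz.ge

theorem weight_l₁
    (h : LeadingData w u v l₁ l₂ l₃ X Y Z ou ov ox oz o₁ o₂ o₃) : WeightGE w 0 l₁ :=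
  (weightGE_of_orderTop h.mono h.order_l₁).mono h.weight_o₁.ge

theorem weight_l₂
    (h : LeadingData w u v l₁ l₂ l₃ X Y Z ou ov ox oz o₁ o₂ o₃) : WeightGE w 0 l₂ :=
  (weightGE_of_orderTop h.mono h.order_l₂).mono h.weight_o₂.ge

theorem weight_l₃
    (h : LeadingData w u v l₁ l₂ l₃ X Y Z ou ov ox oz o₁ o₂ o₃) : WeightGE w 0 l₃ :=
  (weightGE_of_orderTop h.mono h.order_l₃).mono h.weight_o₃.ge

theorem weight_Y
    (h : LeadingData w u v l₁ l₂ l₃ X Y Z ou ov ox oz o₁ o₂ o₃)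
    (b : ℤ) : WeightGE w 0 (Y b) :=
  (weightGE_of_orderTop h.mono (h.order_Y b)).mono (map_zero w).ge

end LeadingData

variable [IsOrderedAddMonoid Γ]

theorem WeightGE.mul (hx : WeightGE w m x) (hy : WeightGE w m' y) :
    WeightGE w (m + m') (x * y) := by
  intro γ hγ
  obtain ⟨a, ha, b, hb, rfl⟩ := support_mul_subset (mem_support _ _ |>.2 hγ)
  rw [map_add]
  exact add_le_add (hx a ha) (hy b hb)

theorem orderTop_mul_coe (hx : x.orderTop = g) (hy : y.orderTop = g') :
    (x * y).orderTop = ↑(g + g') := by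
  rw [orderTop_mul, hx, hy, WithTop.coe_add]

theorem orderTop_inv_coe (hx : x.orderTop = g) : x⁻¹.orderTop = ↑(-g) := by
  have hx0 : x ≠ 0 := by
    rintro rfl
    simp at hx
  have h := orderTop_mul x x⁻¹
  rw [mul_inv_cancel₀ hx0, orderTop_one, hx] at h
  induction hz : x⁻¹.orderTop using WithTop.recTopCoe with
  | top => simp [hz] at h
  | coe γ =>
    rw [hz] at h
    have h' : g + γ = 0 := by exact_mod_cast h.symm
    rw [eq_neg_of_add_eq_zero_right h']

theorem weightGE_algebraMap (r : F) : WeightGE w 0 (algebraMap F (HahnSeries Γ F) r) := by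
  intro γ hγ
  rw [HahnSeries.algebraMap_apply, C_apply, coeff_single] at hγ
  split_ifs at hγ with h
  · simp [h]
  · exact absurd rfl hγ

theorem orderTop_algebraMap {r : F} (hr : r ≠ 0) :
    (algebraMap F (HahnSeries Γ F) r).orderTop = ((0 : Γ) : WithTop Γ) := by
  rw [HahnSeries.algebraMap_apply, C_apply, orderTop_single (by simpa using hr)]

namespace LeadingData

variable {q : F} {u v l₁ l₂ l₃ : HahnSeries Γ F} {X Y Z : ℤ → HahnSeries Γ F}
  {ou ov ox oz o₁ o₂ o₃ : Γ} {f : ℤ × ℤ × ℤ → HahnSeries Γ F}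

local notation "Q" => algebraMap F (HahnSeries Γ F) q

theorem weight_Q_inv : WeightGE w 0 Q⁻¹ := by
  rw [← map_inv₀]
  exact weightGE_algebraMap _

theorem weight_Q_pow (n : ℕ) : WeightGE w 0 (Q ^ n) := by
  rw [← map_pow]
  exact weightGE_algebraMap _

theorem weight_phi {l x : HahnSeries Γ F} (hl : WeightGE w 0 l) (hx : WeightGE w m x)
    (hx' : WeightGE w m x⁻¹) (hm : m ≤ 0) : WeightGE w m (phi Q l x) :=
  ((hl.mono hm).sub (((weightGE_algebraMap q).mul hx).mono (by omega))).sub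
    ((weight_Q_inv.mul hx').mono (by omega))

theorem weight_u_inv
    (h : LeadingData w u v l₁ l₂ l₃ X Y Z ou ov ox oz o₁ o₂ o₃) : WeightGE w 0 u⁻¹ :=
  (weightGE_of_orderTop h.mono (orderTop_inv_coe h.order_u)).mono (by simp [h.weight_ou])

theorem weight_v_inv
    (h : LeadingData w u v l₁ l₂ l₃ X Y Z ou ov ox oz o₁ o₂ o₃) : WeightGE w 1 v⁻¹ :=
  (weightGE_of_orderTop h.mono (orderTop_inv_coe h.order_v)).mono (by simp [h.weight_ov])

theorem weight_X_inv
    (h : LeadingData w u v l₁ l₂ l₃ X Y Z ou ov ox oz o₁ o₂ o₃)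
    (a : ℤ) : WeightGE w 1 (X a)⁻¹ :=
  (weightGE_of_orderTop h.mono (orderTop_inv_coe (h.order_X a))).mono (by simp [h.weight_ox])

theorem weight_Z_inv
    (h : LeadingData w u v l₁ l₂ l₃ X Y Z ou ov ox oz o₁ o₂ o₃)
    (c : ℤ) : WeightGE w 1 (Z c)⁻¹ :=
  (weightGE_of_orderTop h.mono (orderTop_inv_coe (h.order_Z c))).mono (by simp [h.weight_oz])

theorem weight_Y_inv
    (h : LeadingData w u v l₁ l₂ l₃ X Y Z ou ov ox oz o₁ o₂ o₃)
    (b : ℤ) : WeightGE w 0 (Y b)⁻¹ :=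
  (weightGE_of_orderTop h.mono (orderTop_inv_coe (h.order_Y b))).mono (by simp)

theorem weight_phi_Y
    (h : LeadingData w u v l₁ l₂ l₃ X Y Z ou ov ox oz o₁ o₂ o₃)
    (b : ℤ) : WeightGE w 0 (phi Q l₂ (Y b)) :=
  weight_phi h.weight_l₂ (h.weight_Y b) (h.weight_Y_inv b) le_rfl

theorem weight_phi_X
    (h : LeadingData w u v l₁ l₂ l₃ X Y Z ou ov ox oz o₁ o₂ o₃)
    (a : ℤ) : WeightGE w (-1) (phi Q l₁ (X a)) :=
  weight_phi h.weight_l₁ (h.weight_X a) ((h.weight_X_inv a).mono (by simp)) (by simp)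

theorem weight_phi_Z
    (h : LeadingData w u v l₁ l₂ l₃ X Y Z ou ov ox oz o₁ o₂ o₃)
    (c : ℤ) : WeightGE w (-1) (phi Q l₃ (Z c)) :=
  weight_phi h.weight_l₃ (h.weight_Z c) ((h.weight_Z_inv c).mono (by simp)) (by simp)

theorem hasLead_actB
    (h : LeadingData w u v l₁ l₂ l₃ X Y Z ou ov ox oz o₁ o₂ o₃)
    (hq0 : q ≠ 0) (hf : HasLead f g) :
    HasLead (actB Q v l₂ l₃ Y Z f) (ov + oz + g) := by
  rintro ⟨a, b, c⟩
  have WQ : WeightGE w 0 Q := weightGE_algebraMap q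
  have WQ' : WeightGE w 0 Q⁻¹ := weight_Q_inv
  have Wf (n) := weightGE_of_orderTop h.mono (hf n)
  have WZ' := h.weight_Z_inv c
  have lead := orderTop_mul_coe (orderTop_mul_coe h.order_v (orderTop_neg.trans (orderTop_mul_coe
    (orderTop_algebraMap hq0) (h.order_Z c)))) (hf (a, b - 1, c + 1))
  rw [zero_add] at lead
  have split : actB Q v l₂ l₃ Y Z f (a, b, c) =
    v * -(Q * Z c) * f (a, b - 1, c + 1) +
      ((l₂ * (Z c)⁻¹ + l₃ * Y b - (Q + Q⁻¹) * Y b * (Z c)⁻¹) * f (a, b, c)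
      + v * (l₃ - Q⁻¹ * (Z c)⁻¹) * f (a, b - 1, c + 1)
      + v⁻¹ * Q ^ 2 * Y b * (Z c)⁻¹ * phi Q l₂ (Y b) * f (a, b + 1, c - 1)) := by
    simp only [actB, phi]
    ring
  rw [split]
  refine orderTop_add_of_weightGE h.mono lead ?_
  rw [show w (ov + oz + g) + 1 = -1 + w g by simp [h.weight_ov, h.weight_oz]; ring]
  refine ((WeightGE.mul ?_ (Wf _)).add (WeightGE.mul ?_ (Wf _))).add (WeightGE.mul ?_ (Wf _))
  · exact (((h.weight_l₂.mul WZ').mono (by simp)).add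
      ((h.weight_l₃.mul (h.weight_Y b)).mono (by simp))).sub
      ((((WQ.add WQ').mul (h.weight_Y b)).mul WZ').mono (by simp))
  · exact (h.weight_v.mul ((h.weight_l₃.sub ((WQ'.mul WZ').mono (by simp))))).mono (by simp)
  · exact ((((h.weight_v_inv.mul (weight_Q_pow 2)).mul (h.weight_Y b)).mul WZ').mul
      (h.weight_phi_Y b)).mono (by simp)

theorem hasLead_actA
    (h : LeadingData w u v l₁ l₂ l₃ X Y Z ou ov ox oz o₁ o₂ o₃)
    (hq0 : q ≠ 0) (hf : HasLead f g) :
    HasLead (actA Q u l₁ l₂ X Y f) (-ou + ox + ox + g) := by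
  rintro ⟨a, b, c⟩
  have WQ : WeightGE w 0 Q := weightGE_algebraMap q
  have WQ' : WeightGE w 0 Q⁻¹ := weight_Q_inv
  have Wf (n) := weightGE_of_orderTop h.mono (hf n)
  have WX := h.weight_X a
  have WY' := h.weight_Y_inv b
  have hQ2 := orderTop_algebraMap (Γ := Γ) (pow_ne_zero 2 hq0)
  rw [map_pow] at hQ2
  have lead := orderTop_mul_coe (orderTop_mul_coe (orderTop_mul_coe (orderTop_mul_coe
    (orderTop_mul_coe (orderTop_inv_coe h.order_u) hQ2) (h.order_X a))
    (orderTop_inv_coe (h.order_Y b))) (orderTop_neg.trans (orderTop_mul_coe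
    (orderTop_algebraMap hq0) (h.order_X a)))) (hf (a + 1, b - 1, c))
  rw [zero_add, neg_zero, add_zero, add_zero] at lead
  have split : actA Q u l₁ l₂ X Y f (a, b, c) =
    u⁻¹ * Q ^ 2 * X a * (Y b)⁻¹ * -(Q * X a) * f (a + 1, b - 1, c) +
      ((l₁ * (Y b)⁻¹ + l₂ * X a - (Q + Q⁻¹) * X a * (Y b)⁻¹) * f (a, b, c)
      + u * phi Q l₂ (Y b) * f (a - 1, b + 1, c)
      + u⁻¹ * Q ^ 2 * X a * (Y b)⁻¹ * (l₁ - Q⁻¹ * (X a)⁻¹) * f (a + 1, b - 1, c)) := by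
    simp only [actA, phi]
    ring
  rw [split]
  refine orderTop_add_of_weightGE h.mono lead ?_
  rw [show w (-ou + ox + ox + g) + 1 = -1 + w g by simp [h.weight_ou, h.weight_ox]; ring]
  refine ((WeightGE.mul ?_ (Wf _)).add (WeightGE.mul ?_ (Wf _))).add (WeightGE.mul ?_ (Wf _))
  · exact (((h.weight_l₁.mul WY').mono (by simp)).add
      ((h.weight_l₂.mul WX).mono (by simp))).sub
      ((((WQ.add WQ').mul WX).mul WY').mono (by simp))
  · exact (h.weight_u.mul (h.weight_phi_Y b)).mono (by simp)
  · exact ((((h.weight_u_inv.mul (weight_Q_pow 2)).mul WX).mul WY').mul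
      (h.weight_l₁.sub ((WQ'.mul (h.weight_X_inv a)).mono (by simp)))).mono (by simp)

theorem hasLead_actC
    (h : LeadingData w u v l₁ l₂ l₃ X Y Z ou ov ox oz o₁ o₂ o₃)
    (hq0 : q ≠ 0) (hY : QGeometric Q Y) (hf : HasLead f g) :
    HasLead (actC Q u v l₁ l₂ l₃ X Y Z f) (ou + ov + oz + g) := by
  rintro ⟨a, b, c⟩
  have WQ : WeightGE w 0 Q := weightGE_algebraMap q
  have WQ' : WeightGE w 0 Q⁻¹ := weight_Q_inv
  have WQn (n : ℕ) : WeightGE w 0 (Q ^ n) := weight_Q_pow n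
  have W1 : WeightGE w 0 (1 : HahnSeries Γ F) := by simpa using WQn 0
  have Wf (n) := weightGE_of_orderTop h.mono (hf n)
  have WX := h.weight_X a
  have WY := h.weight_Y b
  have WZ' := h.weight_Z_inv c
  have Wphi := h.weight_phi_Y (q := q)
  have Wuv : WeightGE w 1 (u * v)⁻¹ := by
    rw [mul_inv]
    exact (h.weight_u_inv.mul h.weight_v_inv).mono (by simp)
  have lead := orderTop_mul_coe (orderTop_mul_coe (orderTop_mul_coe (orderTop_mul_coe
    h.order_u h.order_v) (h.order_Y b)) (orderTop_neg.trans (orderTop_mul_coe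
    (orderTop_algebraMap hq0) (h.order_Z c)))) (hf (a - 1, b, c + 1))
  rw [zero_add, add_zero] at lead
  have split : actC Q u v l₁ l₂ l₃ X Y Z f (a, b, c) =
    u * v * Y b * -(Q * Z c) * f (a - 1, b, c + 1) +
      ((l₁ * (Z c)⁻¹ + l₃ * X a - (Q + Q⁻¹) * X a * (Z c)⁻¹) * f (a, b, c)
      + u * v * Y b * (l₃ - Q⁻¹ * (Z c)⁻¹) * f (a - 1, b, c + 1)
      + Q ^ 2 * (u * v)⁻¹ * X a * (Y b)⁻¹ * (Z c)⁻¹ * phi Q l₁ (X a) * f (a + 1, b, c - 1)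
      + v⁻¹ * phi Q l₂ (Y b) * (Z c)⁻¹ * ((Q ^ 2 + 1) * X a - Q * l₁) * f (a, b + 1, c - 1)
      + u * phi Q l₂ (Y b) * ((Q ^ 2 + 1) * Y b * (Z c)⁻¹ - Q * l₃ * Y b) * f (a - 1, b + 1, c)
      - Q ^ 3 * u * v⁻¹ * Y b * (Z c)⁻¹ * phi Q l₂ (Y b) * phi Q l₂ (Y (b + 1))
        * f (a - 1, b + 1 + 1, c - 1)) := by
    simp only [actC, phi, hY.add_one]
    ring
  rw [split]
  refine orderTop_add_of_weightGE h.mono lead ?_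
  rw [show w (ou + ov + oz + g) + 1 = -1 + w g by
    simp [h.weight_ou, h.weight_ov, h.weight_oz]; ring]
  refine (((((WeightGE.mul ?_ (Wf _)).add (WeightGE.mul ?_ (Wf _))).add
    (WeightGE.mul ?_ (Wf _))).add (WeightGE.mul ?_ (Wf _))).add (WeightGE.mul ?_ (Wf _))).sub
    (WeightGE.mul ?_ (Wf _))
  · exact (((h.weight_l₁.mul WZ').mono (by simp)).add
      ((h.weight_l₃.mul WX).mono (by simp))).sub
      ((((WQ.add WQ').mul WX).mul WZ').mono (by simp))
  · exact (((h.weight_u.mul h.weight_v).mul WY).mul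
      (h.weight_l₃.sub ((WQ'.mul WZ').mono (by simp)))).mono (by simp)
  · exact ((((((WQn 2).mul Wuv).mul WX).mul (h.weight_Y_inv b)).mul WZ').mul
      (h.weight_phi_X a)).mono (by simp)
  · exact (((h.weight_v_inv.mul (Wphi b)).mul WZ').mul ((((WQn 2).add W1).mul WX).sub
      ((WQ.mul h.weight_l₁).mono (by simp)))).mono (by simp)
  · exact ((h.weight_u.mul (Wphi b)).mul (((((WQn 2).add W1).mul WY).mul WZ').mono (by simp) |>.sub
      ((WQ.mul h.weight_l₃).mul WY))).mono (by simp)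
  · exact (((((((WQn 3).mul h.weight_u).mul h.weight_v_inv).mul WY).mul WZ').mul (Wphi b)).mul
      (Wphi (b + 1))).mono (by simp)

theorem hasLead_actL
    (h : LeadingData w u v l₁ l₂ l₃ X Y Z ou ov ox oz o₁ o₂ o₃)
    (hq0 : q ≠ 0) (hf : HasLead f g) :
    HasLead (actL Q u v l₁ l₂ l₃ X Y Z f) (ox + (ov + oz) + g) := by
  rintro ⟨a, b, c⟩
  have WQ : WeightGE w 0 Q := weightGE_algebraMap q
  have WQ' : WeightGE w 0 Q⁻¹ := weight_Q_inv
  have Wf (n) := weightGE_of_orderTop h.mono (hf n)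
  have WX := h.weight_X a
  have WY' := h.weight_Y_inv b
  have WZ' := h.weight_Z_inv c
  have Wuv : WeightGE w 1 (u * v)⁻¹ := by
    rw [mul_inv]
    exact (h.weight_u_inv.mul h.weight_v_inv).mono (by simp)
  have lead := orderTop_mul_coe (h.order_X a) (h.hasLead_actB hq0 hf (a, b, c))
  rw [← add_assoc] at lead
  have split : actL Q u v l₁ l₂ l₃ X Y Z f (a, b, c) =
    X a * actB Q v l₂ l₃ Y Z f (a, b, c) +
      ((l₁ - (Q + Q⁻¹) * X a) * (Y b)⁻¹ * (Z c)⁻¹ * f (a, b, c)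
      + u * phi Q l₂ (Y b) * (Z c)⁻¹ * f (a - 1, b + 1, c)
      + u * v * phi Q l₃ (Z c) * f (a - 1, b, c + 1)
      + Q ^ 2 * phi Q l₁ (X a) * X a * (Z c)⁻¹ * (u⁻¹ * (Y b)⁻¹) * f (a + 1, b - 1, c)
      + Q ^ 2 * phi Q l₁ (X a) * X a * (Z c)⁻¹ * (u * v)⁻¹ * f (a + 1, b, c - 1)) := by
    simp only [actL]
    ring
  rw [split]
  refine orderTop_add_of_weightGE h.mono lead ?_
  rw [show w (ox + (ov + oz) + g) + 1 = -2 + w g by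
    simp [h.weight_ox, h.weight_ov, h.weight_oz]; ring]
  refine ((((WeightGE.mul ?_ (Wf _)).add (WeightGE.mul ?_ (Wf _))).add
    (WeightGE.mul ?_ (Wf _))).add (WeightGE.mul ?_ (Wf _))).add (WeightGE.mul ?_ (Wf _))
  · exact ((((h.weight_l₁.mono (by simp)).sub ((WQ.add WQ').mul WX)).mul WY').mul WZ').mono
      (by simp)
  · exact ((h.weight_u.mul (h.weight_phi_Y b)).mul WZ').mono (by simp)
  · exact ((h.weight_u.mul h.weight_v).mul (h.weight_phi_Z c)).mono (by simp)
  · exact (((((weight_Q_pow 2).mul (h.weight_phi_X a)).mul WX).mul WZ').mul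
      (h.weight_u_inv.mul WY')).mono (by simp)
  · exact (((((weight_Q_pow 2).mul (h.weight_phi_X a)).mul WX).mul WZ').mul Wuv).mono (by simp)

theorem hasLead_central
    (h : LeadingData w u v l₁ l₂ l₃ X Y Z ou ov ox oz o₁ o₂ o₃)
    (hq0 : q ≠ 0) (hf : HasLead f g) {l r : HahnSeries Γ F} {o : Γ}
    (hl : l.orderTop = o) (ho : w o = 0) (hr : WeightGE w 0 r) :
    HasLead (fun n => r * f n + l * actL Q u v l₁ l₂ l₃ X Y Z f n)
      (o + (ox + (ov + oz)) + g) := by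
  intro n
  have lead := orderTop_mul_coe hl (h.hasLead_actL hq0 hf n)
  rw [← add_assoc] at lead
  simp only
  rw [add_comm]
  refine orderTop_add_of_weightGE h.mono lead
    ((hr.mul (weightGE_of_orderTop h.mono (hf n))).mono ?_)
  simp [ho, h.weight_ox, h.weight_ov, h.weight_oz]

end LeadingData

end leading

theorem map_orderedMonomial {S T : Type*} [Monoid S] [Monoid T] {G : Type*} [FunLike G S T]
    [MonoidHomClass G S T] (φ : G) (A B C a b c : S) (e : Fin 6 → ℕ) :
    φ (orderedMonomial A B C a b c e) =
      orderedMonomial (φ A) (φ B) (φ C) (φ a) (φ b) (φ c) e := by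
  simp [orderedMonomial]

section independence

open HahnSeries

variable {F : Type*} [Field F]

theorem linearIndependent_of_orderTop {Γ ι : Type*} [LinearOrder Γ] {x : ι → HahnSeries Γ F}
    {g : ι → Γ} (hg : Function.Injective g) (hx : ∀ i, (x i).orderTop = g i) :
    LinearIndependent F x := by
  classical
  rw [linearIndependent_iff']
  intro s c hc i hi
  by_contra hci
  obtain ⟨j, hj, hmin⟩ := (s.filter fun i => c i ≠ 0).exists_min_image g
    ⟨i, Finset.mem_filter.2 ⟨hi, hci⟩⟩
  rw [Finset.mem_filter] at hj
  have h := congrArg (fun y : HahnSeries Γ F => y.coeff (g j)) hc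
  simp only [coeff_sum, coeff_smul, coeff_zero] at h
  rw [Finset.sum_eq_single j] at h
  · exact smul_ne_zero hj.2 (coeff_orderTop_ne (hx j)) h
  · intro k hk hkj
    by_cases hck : c k = 0
    · simp [hck]
    · rw [coeff_eq_zero_of_lt_orderTop, smul_zero]
      rw [hx, WithTop.coe_lt_coe]
      exact lt_of_le_of_ne (hmin k (Finset.mem_filter.2 ⟨hk, hck⟩)) (hg.ne hkj.symm)
  · exact fun h => absurd hj.1 h

variable {Γ : Type*} [AddCommGroup Γ] [LinearOrder Γ]

/-- `T` shifts the order of every function with constant order by `o`. -/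
def ShiftsLead (T : Module.End F (ℤ × ℤ × ℤ → HahnSeries Γ F)) (o : Γ) : Prop :=
  ∀ ⦃f g⦄, HasLead f g → HasLead (T f) (o + g)

theorem ShiftsLead.mul {T T' : Module.End F (ℤ × ℤ × ℤ → HahnSeries Γ F)} {o o' : Γ}
    (hT : ShiftsLead T o) (hT' : ShiftsLead T' o') : ShiftsLead (T * T') (o + o') := by
  intro f g hf
  rw [add_assoc]
  exact hT (hT' hf)

theorem ShiftsLead.pow {T : Module.End F (ℤ × ℤ × ℤ → HahnSeries Γ F)} {o : Γ}
    (hT : ShiftsLead T o) (n : ℕ) : ShiftsLead (T ^ n) (n • o) := by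
  induction n with
  | zero => intro f g hf; simpa using hf
  | succ n ih => rw [pow_succ, succ_nsmul]; exact ih.mul hT

theorem shiftsLead_orderedMonomial {A B C a b c : Module.End F (ℤ × ℤ × ℤ → HahnSeries Γ F)}
    {oA oB oC oa ob oc : Γ} (hA : ShiftsLead A oA) (hB : ShiftsLead B oB) (hC : ShiftsLead C oC)
    (ha : ShiftsLead a oa) (hb : ShiftsLead b ob) (hc : ShiftsLead c oc) (e : Fin 6 → ℕ) :
    ShiftsLead (orderedMonomial A B C a b c e)
      (e 0 • oA + (e 1 • oB + (e 2 • oC + (e 3 • oa + (e 4 • ob + e 5 • oc))))) :=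
  (hA.pow _).mul ((hB.pow _).mul ((hC.pow _).mul ((ha.pow _).mul ((hb.pow _).mul (hc.pow _)))))

end independence

section parameters

open HahnSeries

/-- The exponent of the monomial with coordinates `x` in a lexicographically ordered lattice. -/
def lexVec (x : Fin 6 → ℤ) : Lex (Fin 6 → ℤ) := toLex x

theorem lexVec_add (x y : Fin 6 → ℤ) : lexVec x + lexVec y = lexVec (x + y) := rfl

theorem lexVec_neg (x : Fin 6 → ℤ) : -lexVec x = lexVec (-x) := rfl

theorem ofLex_nsmul_lexVec (n : ℕ) (x : Fin 6 → ℤ) (i : Fin 6) :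
    ofLex (n • lexVec x) i = n * x i :=
  nsmul_eq_mul n (x i)

/-- The first coordinate on `ℤ⁶`. -/
def lexFst : Lex (Fin 6 → ℤ) →+ ℤ where
  toFun x := ofLex x 0
  map_zero' := rfl
  map_add' _ _ := rfl

theorem lexFst_mono : Monotone lexFst := by
  intro x y h
  rcases h.eq_or_lt with rfl | ⟨i, hi, hlt⟩
  · exact le_rfl
  · rcases (Fin.zero_le i).eq_or_lt with rfl | h0
    · exact hlt.le
    · exact (hi 0 h0).le

variable {Γ F : Type*} [AddCommGroup Γ] [LinearOrder Γ] [IsOrderedAddMonoid Γ] [Field F]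

theorem qGeometric_single {q : F} (hq0 : q ≠ 0) (g : Γ) :
    QGeometric (algebraMap F (HahnSeries Γ F) q) (fun a : ℤ => single g (q ^ (2 * a))) where
  ne_zero a := single_ne_zero (zpow_ne_zero _ hq0)
  add_one a := by
    rw [← map_pow, HahnSeries.algebraMap_apply, C_apply, single_mul_single, zero_add, mul_add,
      zpow_add₀ hq0, mul_comm]
    norm_cast

theorem leadingData_single {q : F} (hq0 : q ≠ 0) :
    LeadingData lexFst (single (lexVec ![0, 0, 1, 0, 0, 0]) (1 : F))
      (single (lexVec ![-1, 0, 0, 0, 0, 0]) 1)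
      (single (lexVec ![0, 0, 0, 1, 0, 0]) 1) (single (lexVec ![0, 0, 0, 0, 1, 0]) 1)
      (single (lexVec ![0, 0, 0, 0, 0, 1]) 1)
      (fun a : ℤ => single (lexVec ![-1, 1, 0, 0, 0, 0]) (q ^ (2 * a)))
      (fun b : ℤ => single 0 (q ^ (2 * b)))
      (fun c : ℤ => single (lexVec ![-1, 0, 0, 0, 0, 0]) (q ^ (2 * c)))
      (lexVec ![0, 0, 1, 0, 0, 0]) (lexVec ![-1, 0, 0, 0, 0, 0]) (lexVec ![-1, 1, 0, 0, 0, 0])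
      (lexVec ![-1, 0, 0, 0, 0, 0]) (lexVec ![0, 0, 0, 1, 0, 0]) (lexVec ![0, 0, 0, 0, 1, 0])
      (lexVec ![0, 0, 0, 0, 0, 1]) where
  mono := lexFst_mono
  order_u := orderTop_single one_ne_zero
  order_v := orderTop_single one_ne_zero
  order_X _ := orderTop_single (zpow_ne_zero _ hq0)
  order_Y _ := orderTop_single (zpow_ne_zero _ hq0)
  order_Z _ := orderTop_single (zpow_ne_zero _ hq0)
  order_l₁ := orderTop_single one_ne_zero
  order_l₂ := orderTop_single one_ne_zero
  order_l₃ := orderTop_single one_ne_zero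
  weight_ou := rfl
  weight_ov := rfl
  weight_ox := rfl
  weight_oz := rfl
  weight_o₁ := rfl
  weight_o₂ := rfl
  weight_o₃ := rfl

/-- The order of the value of the ordered monomial with exponent `e` at the constant function. -/
def monomialOrder (e : Fin 6 → ℕ) : Lex (Fin 6 → ℤ) :=
  e 0 • lexVec ![-2, 2, -1, 0, 0, 0] + (e 1 • lexVec ![-2, 0, 0, 0, 0, 0] +
    (e 2 • lexVec ![-2, 0, 1, 0, 0, 0] + (e 3 • lexVec ![-3, 1, 0, 0, 0, 1] +
      (e 4 • lexVec ![-3, 1, 0, 1, 0, 0] + e 5 • lexVec ![-3, 1, 0, 0, 1, 0]))))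

theorem monomialOrder_injective : Function.Injective monomialOrder := by
  intro e e' h
  have h (i : Fin 6) := congrFun (congrArg ofLex h) i
  simp only [monomialOrder, ofLex_add, Pi.add_apply, ofLex_nsmul_lexVec] at h
  have h0 := h 0
  have h1 := h 1
  have h2 := h 2
  have h3 := h 3
  have h4 := h 4
  have h5 := h 5
  simp at h0 h1 h2 h3 h4 h5
  ext i
  fin_cases i <;> simp <;> omega

end parameters

/-- The algebra homomorphism `♭ : △_q → U_q(sl₂)^{⊗3}` determined
by `A ↦ Δ(Λ)⊗1`, `B ↦ 1⊗Δ(Λ)`, `γ ↦ Λ⊗1⊗Λ + (1⊗Λ⊗1)·Δ₂(Λ)` is injective. -/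
theorem aw_embedding_injective (F : Type) [Field F] (q : F) (hq0 : q ≠ 0)
    (hq4 : q ^ 4 ≠ 1)
    (Δ : UqAlg F q →ₐ[F] UqAlg F q ⊗[F] UqAlg F q)
    (hΔE : Δ (UqE F q) = UqE F q ⊗ₜ[F] 1 + UqK F q ⊗ₜ[F] UqE F q)
    (hΔF : Δ (UqF F q) = UqF F q ⊗ₜ[F] UqKinv F q + 1 ⊗ₜ[F] UqF F q)
    (hΔK : Δ (UqK F q) = UqK F q ⊗ₜ[F] UqK F q)
    (hΔKinv : Δ (UqKinv F q) = UqKinv F q ⊗ₜ[F] UqKinv F q)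
    (Δ₂ : UqAlg F q →ₐ[F] UqAlg F q ⊗[F] (UqAlg F q ⊗[F] UqAlg F q))
    (hΔ₂ : Δ₂ = (Algebra.TensorProduct.map (AlgHom.id F (UqAlg F q)) Δ).comp Δ)
    (flat : AWAlg F q →ₐ[F] UqAlg F q ⊗[F] (UqAlg F q ⊗[F] UqAlg F q))
    (hA : flat (AWA F q) =
        (Algebra.TensorProduct.map (AlgHom.id F (UqAlg F q))
          (Algebra.TensorProduct.includeLeft :
            UqAlg F q →ₐ[F] UqAlg F q ⊗[F] UqAlg F q)) (Δ (UqLam F q)))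
    (hB : flat (AWB F q) =
        (Algebra.TensorProduct.includeRight :
          UqAlg F q ⊗[F] UqAlg F q →ₐ[F] UqAlg F q ⊗[F] (UqAlg F q ⊗[F] UqAlg F q))
          (Δ (UqLam F q)))
    (hγ : flat (AWgamma F q) =
        UqLam F q ⊗ₜ[F] ((1 : UqAlg F q) ⊗ₜ[F] UqLam F q) +
          ((1 : UqAlg F q) ⊗ₜ[F] (UqLam F q ⊗ₜ[F] (1 : UqAlg F q))) * Δ₂ (UqLam F q)) :
    Function.Injective ⇑flat := by
  have hu : HahnSeries.single (lexVec ![0, 0, 1, 0, 0, 0]) (1 : F) ≠ 0 :=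
    HahnSeries.single_ne_zero one_ne_zero
  have hv : HahnSeries.single (lexVec ![-1, 0, 0, 0, 0, 0]) (1 : F) ≠ 0 :=
    HahnSeries.single_ne_zero one_ne_zero
  have hX := qGeometric_single hq0 (lexVec ![-1, 1, 0, 0, 0, 0])
  have hY := qGeometric_single hq0 (0 : Lex (Fin 6 → ℤ))
  have hZ := qGeometric_single hq0 (lexVec ![-1, 0, 0, 0, 0, 0])
  have D := leadingData_single hq0
  let π := (tripleRep hq0 hq4 _ _ (HahnSeries.single (lexVec ![0, 0, 0, 1, 0, 0]) 1)
    (HahnSeries.single (lexVec ![0, 0, 0, 0, 1, 0]) 1)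
    (HahnSeries.single (lexVec ![0, 0, 0, 0, 0, 1]) 1) hu hv hX hY hZ).comp flat
  have πA f : π (AWA F q) f = _ :=
    (congrArg (fun t => tripleRep hq0 hq4 _ _ _ _ _ hu hv hX hY hZ t f) hA).trans
      (tripleRep_A hq0 hq4 _ _ _ _ _ hu hv hX hY hZ Δ hΔE hΔF hΔK hΔKinv f)
  have πB f : π (AWB F q) f = _ :=
    (congrArg (fun t => tripleRep hq0 hq4 _ _ _ _ _ hu hv hX hY hZ t f) hB).trans
      (tripleRep_B hq0 hq4 _ _ _ _ _ hu hv hX hY hZ Δ hΔE hΔF hΔK hΔKinv f)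
  have πγ f n : π (AWgamma F q) f n = _ :=
    (congrArg (fun t => tripleRep hq0 hq4 _ _ _ _ _ hu hv hX hY hZ t f n)
      (hγ.trans (by rw [hΔ₂]; rfl))).trans
      (tripleRep_gamma hq0 hq4 _ _ _ _ _ hu hv hX hY hZ Δ hΔE hΔF hΔK hΔKinv f n)
  have πC := awRep_C hq0 hq4 hu hv hX hY hZ πA πB πγ
  have πα := awRep_alpha hq0 hq4 hu hv hX hY hZ πA πB πC
  have πβ := awRep_beta hq0 hq4 hu hv hX hY hZ πA πB πC
  have lead (e : Fin 6 → ℕ) : (π (orderedMonomial (AWA F q) (AWB F q) (AWC F q) (AWalpha F q)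
      (AWbeta F q) (AWgamma F q) e) 1 0).orderTop = monomialOrder e := by
    rw [map_orderedMonomial, ← add_zero (monomialOrder e)]
    refine shiftsLead_orderedMonomial ?_ ?_ ?_ ?_ ?_ ?_ e (fun _ => HahnSeries.orderTop_one) 0
    · intro f g hf
      rw [πA]
      convert D.hasLead_actA hq0 hf using 2
      simp [lexVec_add, lexVec_neg]
    · intro f g hf
      rw [πB]
      convert D.hasLead_actB hq0 hf using 2
      simp [lexVec_add]
    · intro f g hf
      rw [πC]
      convert D.hasLead_actC hq0 hY hf using 2
      simp [lexVec_add]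
    · intro f g hf
      rw [funext (πα f)]
      convert D.hasLead_central hq0 hf D.order_l₃ D.weight_o₃ (D.weight_l₁.mul D.weight_l₂) using 2
      simp [lexVec_add]
    · intro f g hf
      rw [funext (πβ f)]
      convert D.hasLead_central hq0 hf D.order_l₁ D.weight_o₁ (D.weight_l₂.mul D.weight_l₃) using 2
      simp [lexVec_add]
    · intro f g hf
      rw [funext (πγ f)]
      convert D.hasLead_central hq0 hf D.order_l₂ D.weight_o₂ (D.weight_l₁.mul D.weight_l₃) using 2
      simp [lexVec_add]
  have indep := linearIndependent_of_orderTop monomialOrder_injective lead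
  rw [injective_iff_map_eq_zero]
  intro x hx
  have hmem : x ∈ Submodule.span F (Set.range (orderedMonomial (AWA F q) (AWB F q) (AWC F q)
      (AWalpha F q) (AWbeta F q) (AWgamma F q))) := by
    rw [aw_span_orderedMonomial hq0 hq4]
    trivial
  obtain ⟨c, rfl⟩ := Finsupp.mem_span_range_iff_exists_finsupp.1 hmem
  have hπ : π (c.sum fun e r => r • orderedMonomial (AWA F q) (AWB F q) (AWC F q)
      (AWalpha F q) (AWbeta F q) (AWgamma F q) e) 1 0 = 0 := by
    rw [AlgHom.comp_apply, hx, map_zero]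
    rfl
  have hc : c = 0 := by
    refine linearIndependent_iff.1 indep c ?_
    rw [← hπ, Finsupp.linearCombination_apply]
    simp [Finsupp.sum, LinearMap.sum_apply, Finset.sum_apply]
  simp [hc]
end

section
/- In the universal Askey–Wilson algebra △_q, the Casimir element Ω = qABC + q^2A^2 + q^{-2}B^2 + q^2C^2 − qAα − q^{-1}Bβ − qCγ commutes with each of the generators A, B, C. -/
/-- Multiplying the relation `a = (q + q⁻¹)(x + (q y z - q⁻¹ z y) / (q² - q⁻²))` out by
`q - q⁻¹` and solving for `z * y`. -/
lemma aw_mul_swap {F U : Type*} [Field F] {q : F} (hq0 : q ≠ 0) (hq4 : q ^ 4 ≠ 1)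
    [Ring U] [Algebra F U] {x y z a : U}
    (h : a = (q + q⁻¹) • (x + (q ^ 2 - q⁻¹ ^ 2)⁻¹ • (q • (y * z) - q⁻¹ • (z * y)))) :
    z * y = q ^ 2 • (y * z) - (q ^ 2 - 1) • a + (q * (q ^ 2 - q⁻¹ ^ 2)) • x := by
  have hq4' : q ^ 4 - 1 ≠ 0 := sub_ne_zero.mpr hq4
  have hr : q ^ 2 - q⁻¹ ^ 2 ≠ 0 := by
    have : q ^ 2 - q⁻¹ ^ 2 = (q ^ 4 - 1) / q ^ 2 := by field_simp
    rw [this]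
    exact div_ne_zero hq4' (pow_ne_zero 2 hq0)
  have hinv : (q ^ 2 - 1) * (q + q⁻¹) * (q ^ 2 - q⁻¹ ^ 2)⁻¹ = q := by
    rw [mul_inv_eq_iff_eq_mul₀ hr]
    field_simp
    ring
  have key : (q ^ 2 - 1) • a =
      (q * (q ^ 2 - q⁻¹ ^ 2)) • x + q • (q • (y * z) - q⁻¹ • (z * y)) := by
    rw [h, smul_smul, smul_add, smul_smul, hinv]
    congr 2
    field_simp
    ring
  rw [key]
  match_scalars <;> field_simp <;> ring

/-- The relation of `aw_mul_swap` solved for `y * z`. -/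
lemma aw_mul_swap' {F U : Type*} [Field F] {q : F} (hq0 : q ≠ 0) (hq4 : q ^ 4 ≠ 1)
    [Ring U] [Algebra F U] {x y z a : U}
    (h : a = (q + q⁻¹) • (x + (q ^ 2 - q⁻¹ ^ 2)⁻¹ • (q • (y * z) - q⁻¹ • (z * y)))) :
    y * z = q⁻¹ ^ 2 • (z * y) + (1 - q⁻¹ ^ 2) • a - (q⁻¹ * (q ^ 2 - q⁻¹ ^ 2)) • x := by
  rw [aw_mul_swap hq0 hq4 h]
  match_scalars <;> field_simp <;> ring

/-- In the universal Askey–Wilson algebra `△_q`, the Casimir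
element `Ω = qABC + q²A² + q⁻²B² + q²C² − qAα − q⁻¹Bβ − qCγ` commutes with each of
the generators `A`, `B`, `C`.  (Stated in an arbitrary algebra with elements
`A`, `B`, `C`, `α`, `β`, `γ` satisfying the defining relations of `△_q`.) -/
theorem aw_casimir_commutes (F : Type*) [Field F] (q : F) (hq0 : q ≠ 0)
    (hq4 : q ^ 4 ≠ 1)
    (U : Type*) [Ring U] [Algebra F U] (A B C α β γ : U)
    (hα : α = (q + q⁻¹) • (A + (q ^ 2 - q⁻¹ ^ 2)⁻¹ • (q • (B * C) - q⁻¹ • (C * B))))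
    (hβ : β = (q + q⁻¹) • (B + (q ^ 2 - q⁻¹ ^ 2)⁻¹ • (q • (C * A) - q⁻¹ • (A * C))))
    (hγ : γ = (q + q⁻¹) • (C + (q ^ 2 - q⁻¹ ^ 2)⁻¹ • (q • (A * B) - q⁻¹ • (B * A))))
    (hαA : Commute α A) (hαB : Commute α B) (hαC : Commute α C)
    (hβA : Commute β A) (hβB : Commute β B) (hβC : Commute β C)
    (hγA : Commute γ A) (hγB : Commute γ B) (hγC : Commute γ C)
    (Ω : U)
    (hΩ : Ω = q • (A * B * C) + q ^ 2 • A ^ 2 + q⁻¹ ^ 2 • B ^ 2 + q ^ 2 • C ^ 2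
        - q • (A * α) - q⁻¹ • (B * β) - q • (C * γ)) :
    Commute Ω A ∧ Commute Ω B ∧ Commute Ω C := by
  have hBA := aw_mul_swap hq0 hq4 hγ
  have hCB := aw_mul_swap hq0 hq4 hα
  have hCA := aw_mul_swap' hq0 hq4 hβ
  have commute_of_generators : ∀ {z : U}, Commute z A → Commute z B → Commute z C →
      Commute z β ∧ Commute z γ := by
    intro z hA hB hC
    rw [hβ, hγ]
    exact ⟨(hB.add_right ((((hC.mul_right hA).smul_right _).sub_right
        ((hA.mul_right hC).smul_right _)).smul_right _)).smul_right _,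
      (hC.add_right ((((hA.mul_right hB).smul_right _).sub_right
        ((hB.mul_right hA).smul_right _)).smul_right _)).smul_right _⟩
  obtain ⟨hαβ, hαγ⟩ := commute_of_generators hαA hαB hαC
  obtain ⟨-, hβγ⟩ := commute_of_generators hβA hβB hβC
  clear hα hβ hγ commute_of_generators
  have hBA' (x : U) := congrArg (· * x) hBA
  have hCB' (x : U) := congrArg (· * x) hCB
  have hCA' (x : U) := congrArg (· * x) hCA
  simp only [mul_assoc, add_mul, sub_mul, smul_mul_assoc] at hBA' hCB' hCA'
  subst hΩ
  refine ⟨?_, ?_, ?_⟩ <;>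
  · rw [Commute, SemiconjBy]
    simp only [pow_two A, pow_two B, pow_two C, mul_assoc, mul_add, add_mul, mul_sub, sub_mul,
      smul_mul_assoc, mul_smul_comm, smul_add, smul_sub, hBA, hCB, hCA, hBA', hCB', hCA',
      ← hαA.eq, ← hαB.eq, ← hαC.eq, ← hβA.eq, ← hβB.eq, ← hβC.eq, ← hγA.eq, ← hγB.eq, ← hγC.eq,
      ← hαA.left_comm, ← hαB.left_comm, ← hαC.left_comm, ← hβA.left_comm, ← hβB.left_comm,
      ← hβC.left_comm, ← hγA.left_comm, ← hγB.left_comm, ← hγC.left_comm,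
      ← hαβ.eq, ← hαγ.eq, ← hβγ.eq]
    match_scalars <;> field_simp <;> ring
end
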